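/- arXiv:2106.11835 — 4 statements merged into one kernel-verified Lean document; each statement's English description precedes it below -/
import Mathlib

section
/- Let S be a Markov–Schwarz operator on a unital C*-algebra A, let x ∈ A, let (N_i)_{i∈I} be a net of positive integers indexed by a directed set I that tends to infinity, and let μ_i be a state on A for every i ∈ I. Then limsup_i |⟨(1/N_i) Σ_{n=0}^{N_i−1} Sⁿ x, μ_i⟩|² ≤ liminf_{J→∞} (1/J) Σ_{j=1}^J limsup_i (1/N_i) Σ_{n=0}^{N_i−1} Re⟨Sⁿ((S^j x)* x), μ_i⟩. -/
open Filter Finset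
open scoped ComplexOrder

open scoped Topology InnerProductSpace

/-- For a contraction `T` of a Hilbert space fixing a vector `e` of norm at most one, the averaged
correlations of `ξ` along `T` converge to a limit that dominates `‖⟪e, ξ⟫‖ ^ 2`. -/
theorem ContinuousLinearMap.exists_tendsto_average_re_inner_pow {H : Type*} [NormedAddCommGroup H]
    [InnerProductSpace ℂ H] [CompleteSpace H] (T : H →L[ℂ] H) (hT : ‖T‖ ≤ 1) {e : H}
    (he : T e = e) (he1 : ‖e‖ ≤ 1) (ξ : H) :
    ∃ L : ℝ, ‖⟪e, ξ⟫_ℂ‖ ^ 2 ≤ L ∧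
      Tendsto (fun J : ℕ => (J : ℝ)⁻¹ * ∑ j ∈ Icc 1 J, (⟪(T ^ j) ξ, ξ⟫_ℂ).re) atTop (𝓝 L) := by
  set K := T.eqLocus (1 : H →L[ℂ] H)
  set p : K := K.orthogonalProjectionOnto ξ
  have hp : T p = p := p.2
  have heK : e ∈ K := he
  have hpξ : ⟪(p : H), ξ⟫_ℂ = ⟪(p : H), (p : H)⟫_ℂ := by
    have := K.inner_orthogonalProjectionOnto_eq_of_mem_left p ξ
    rw [← this]; rfl
  have heξ : ⟪e, ξ⟫_ℂ = ⟪e, (p : H)⟫_ℂ := by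
    have := K.inner_orthogonalProjectionOnto_eq_of_mem_left ⟨e, heK⟩ ξ
    rw [← this]; rfl
  refine ⟨‖(p : H)‖ ^ 2, ?_, ?_⟩
  · rw [heξ]
    gcongr
    exact (norm_inner_le_norm _ _).trans (mul_le_of_le_one_left (norm_nonneg _) he1)
  · have h1 := T.tendsto_birkhoffAverage_orthogonalProjection hT ξ
    have h2 := (T.continuous.tendsto _).comp h1
    have h3 : Tendsto (fun v : H => (⟪v, ξ⟫_ℂ).re) (𝓝 (T p)) (𝓝 (⟪T p, ξ⟫_ℂ).re) :=
      (Complex.continuous_re.comp (continuous_id.inner continuous_const)).tendsto _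
    have h4 := h3.comp h2
    rw [hp, hpξ, inner_self_eq_norm_sq_to_K] at h4
    convert h4 using 1
    · ext J
      simp only [Function.comp_apply, birkhoffAverage, birkhoffSum, map_smul, map_sum, id]
      rw [inner_smul_left, sum_inner, map_inv₀, Complex.conj_natCast, ← Complex.ofReal_natCast,
        ← Complex.ofReal_inv, Complex.re_ofReal_mul, Complex.re_sum,
        ← Finset.Ico_add_one_right_eq_Icc, sum_Ico_eq_sum_range]
      simp [add_comm 1, pow_succ']
    · congr 1
      norm_cast

section CStarAlgebra

variable {A : Type*} [CStarAlgebra A] [PartialOrder A] [StarOrderedRing A]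

theorem map_nonneg_of_schwarz (S : A →L[ℂ] A)
    (hS : ∀ x : A, star (S x) * S x ≤ S (star x * x)) {a : A} (ha : 0 ≤ a) : 0 ≤ S a := by
  obtain ⟨b, rfl⟩ := CStarAlgebra.nonneg_iff_eq_star_mul_self.mp ha
  exact (star_mul_self_nonneg _).trans (hS b)

theorem opNorm_le_one_of_schwarz (S : A →L[ℂ] A) (hS1 : S 1 = 1)
    (hS : ∀ x : A, star (S x) * S x ≤ S (star x * x)) : ‖S‖ ≤ 1 := by
  refine S.opNorm_le_bound zero_le_one fun a => ?_
  let P : A →ₚ[ℂ] A := .mk₀ S.toLinearMap fun b hb => map_nonneg_of_schwarz S hS hb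
  have hone : ‖(1 : A)‖ ≤ 1 := by
    rcases subsingleton_or_nontrivial A with _ | _
    · simp [Subsingleton.elim (1 : A) 0]
    · exact CStarRing.norm_one.le
  have h1 : ‖S (star a * a)‖ ≤ ‖S 1‖ * ‖star a * a‖ :=
    P.norm_apply_le_of_nonneg _ (star_mul_self_nonneg a)
  have h2 := CStarAlgebra.norm_le_norm_of_nonneg_of_le (star_mul_self_nonneg (S a)) (hS a)
  rw [hS1] at h1
  rw [CStarRing.norm_star_mul_self] at h1 h2
  rw [one_mul]
  refine le_of_sq_le_sq ?_ (norm_nonneg a)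
  nlinarith [mul_le_of_le_one_left (mul_self_nonneg ‖a‖) hone]

/-- The van der Corput inequality for an invariant positive functional, where the averaged
correlations converge. -/
theorem exists_tendsto_average_re_of_invariant (S : A →L[ℂ] A) (hS1 : S 1 = 1)
    (hS : ∀ x : A, star (S x) * S x ≤ S (star x * x)) (ν : A →ₚ[ℂ] ℂ) (hν1 : (ν 1).re ≤ 1)
    (hνS : ∀ a, ν (S a) = ν a) (x : A) :
    ∃ L : ℝ, ‖ν x‖ ^ 2 ≤ L ∧
      Tendsto (fun J : ℕ => (J : ℝ)⁻¹ * ∑ j ∈ Icc 1 J, (ν (star ((S ^ j) x) * x)).re) atTop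
        (𝓝 L) := by
  let T₀ : ν.PreGNS →L[ℂ] ν.PreGNS :=
    (ν.toPreGNS.toLinearMap ∘ₗ S.toLinearMap ∘ₗ ν.ofPreGNS.toLinearMap).mkContinuous 1 fun a => by
      rw [one_mul, ν.preGNS_norm_def, ν.preGNS_norm_def]
      refine Real.sqrt_le_sqrt ?_
      rw [← hνS (star (ν.ofPreGNS a) * ν.ofPreGNS a)]
      exact (Complex.le_def.mp (OrderHomClass.mono ν (hS (ν.ofPreGNS a)))).1
  have hT₀ : ∀ a, T₀ (ν.toPreGNS a) = ν.toPreGNS (S a) := fun a => rfl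
  let T : ν.GNS →L[ℂ] ν.GNS := T₀.completion
  have hT : ∀ a : ν.PreGNS, T a = (T₀ a : ν.GNS) := fun a =>
    ContinuousLinearMap.completion_apply_coe _ _
  have hTnorm : ‖T‖ ≤ 1 := by
    refine T.opNorm_le_bound zero_le_one fun a => ?_
    induction a using UniformSpace.Completion.induction_on with
    | hp => apply isClosed_le <;> fun_prop
    | ih a =>
      rw [hT, UniformSpace.Completion.norm_coe, UniformSpace.Completion.norm_coe]
      exact T₀.le_of_opNorm_le (LinearMap.mkContinuous_norm_le _ zero_le_one _) a
  have hTpow : ∀ (j : ℕ) (a : A),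
      (T ^ j) (ν.toPreGNS a : ν.GNS) = (ν.toPreGNS ((S ^ j) a) : ν.GNS) := by
    intro j a
    induction j with
    | zero => rfl
    | succ j ih =>
      rw [pow_succ', pow_succ', mul_apply_eq_comp, ih, hT, hT₀]
      rfl
  obtain ⟨L, hL, hlim⟩ := T.exists_tendsto_average_re_inner_pow hTnorm
    (e := (ν.toPreGNS 1 : ν.GNS)) (by rw [hT, hT₀, hS1])
    (by
      rw [UniformSpace.Completion.norm_coe, ν.preGNS_norm_def]
      simpa using hν1)
    (ν.toPreGNS x : ν.GNS)
  refine ⟨L, ?_, ?_⟩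
  · simpa [UniformSpace.Completion.inner_coe, ν.preGNS_inner_def] using hL
  · simpa [hTpow, UniformSpace.Completion.inner_coe, ν.preGNS_inner_def] using hlim

end CStarAlgebra

section Average

variable {E : Type*} [NormedAddCommGroup E] [NormedSpace ℂ E]

/-- The average of the functional `μ` over the first `n` iterates of `S`. -/
noncomputable def averageFunctional (S : E →L[ℂ] E) (μ : E →L[ℂ] ℂ) (n : ℕ) : E →L[ℂ] ℂ :=
  (n : ℂ)⁻¹ • ∑ k ∈ range n, μ.comp (S ^ k)

theorem averageFunctional_apply (S : E →L[ℂ] E) (μ : E →L[ℂ] ℂ) (n : ℕ) (a : E) :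
    averageFunctional S μ n a = (n : ℂ)⁻¹ * ∑ k ∈ range n, μ ((S ^ k) a) := by
  simp [averageFunctional]

theorem norm_pow_apply_le {S : E →L[ℂ] E} (hS : ‖S‖ ≤ 1) (k : ℕ) (a : E) :
    ‖(S ^ k) a‖ ≤ ‖a‖ := by
  induction k with
  | zero => simp
  | succ k ih =>
    rw [pow_succ', mul_apply_eq_comp]
    exact (by simpa using S.le_of_opNorm_le hS _ : ‖S ((S ^ k) a)‖ ≤ ‖(S ^ k) a‖).trans ih

theorem norm_apply_pow_le {S : E →L[ℂ] E} (hS : ‖S‖ ≤ 1) {μ : E →L[ℂ] ℂ} (hμ : ‖μ‖ ≤ 1)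
    (k : ℕ) (a : E) : ‖μ ((S ^ k) a)‖ ≤ ‖a‖ := by
  have h : ‖μ ((S ^ k) a)‖ ≤ ‖(S ^ k) a‖ := by simpa using μ.le_of_opNorm_le hμ ((S ^ k) a)
  exact h.trans (norm_pow_apply_le hS k a)

theorem norm_averageFunctional_apply_le {S : E →L[ℂ] E} (hS : ‖S‖ ≤ 1) {μ : E →L[ℂ] ℂ}
    (hμ : ‖μ‖ ≤ 1) (n : ℕ) (a : E) : ‖averageFunctional S μ n a‖ ≤ ‖a‖ := by
  rw [averageFunctional_apply, norm_mul, norm_inv, Complex.norm_natCast]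
  have h : ‖∑ k ∈ range n, μ ((S ^ k) a)‖ ≤ n * ‖a‖ := by
    simpa using norm_sum_le_of_le (range n) fun k _ => norm_apply_pow_le hS hμ k a
  rcases n.eq_zero_or_pos with rfl | hn
  · simp
  · rw [inv_mul_le_iff₀ (by positivity)]
    exact h

theorem norm_averageFunctional_map_sub_le {S : E →L[ℂ] E} (hS : ‖S‖ ≤ 1) {μ : E →L[ℂ] ℂ}
    (hμ : ‖μ‖ ≤ 1) (n : ℕ) (a : E) :
    ‖averageFunctional S μ n (S a) - averageFunctional S μ n a‖ ≤ (n : ℝ)⁻¹ * (2 * ‖a‖) := by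
  have h : averageFunctional S μ n (S a) - averageFunctional S μ n a =
      (n : ℂ)⁻¹ * (μ ((S ^ n) a) - μ a) := by
    rw [averageFunctional_apply, averageFunctional_apply, ← mul_sub, ← sum_sub_distrib]
    have := sum_range_sub (fun k => μ ((S ^ k) a)) n
    simp only [pow_zero, one_apply_eq_self] at this
    rw [← this]
    simp only [pow_succ, mul_apply_eq_comp]
  rw [h, norm_mul, norm_inv, Complex.norm_natCast]
  gcongr
  have h1 := norm_apply_pow_le hS hμ n a
  have h0 := norm_apply_pow_le hS hμ 0 a
  simp only [pow_zero, one_apply_eq_self] at h0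
  linarith [norm_sub_le (μ ((S ^ n) a)) (μ a)]

/-- Along an ultrafilter, the averaged functionals of a contraction have an invariant limit. -/
theorem exists_invariant_tendsto_averageFunctional {I : Type*} (U : Ultrafilter I)
    {S : E →L[ℂ] E} (hS : ‖S‖ ≤ 1) {μ : I → E →L[ℂ] ℂ} (hμ : ∀ i, ‖μ i‖ ≤ 1) {N : I → ℕ}
    (hN : Tendsto N U atTop) :
    ∃ ν : E →L[ℂ] ℂ, (∀ a, Tendsto (fun i => averageFunctional S (μ i) (N i) a) U (𝓝 (ν a))) ∧
      ∀ a, ν (S a) = ν a := by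
  let φ : I → WeakDual ℂ E := fun i =>
    StrongDual.toWeakDual (averageFunctional S (μ i) (N i))
  have hφ : ∀ i, φ i ∈ WeakDual.toStrongDual ⁻¹' Metric.closedBall (0 : StrongDual ℂ E) 1 := by
    intro i
    rw [Set.mem_preimage, mem_closedBall_zero_iff]
    exact ContinuousLinearMap.opNorm_le_bound _ zero_le_one fun a =>
      (norm_averageFunctional_apply_le hS (hμ i) (N i) a).trans_eq (one_mul _).symm
  obtain ⟨ν, -, hν⟩ := (WeakDual.isCompact_closedBall (0 : StrongDual ℂ E) 1).ultrafilter_le_nhds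
    (U.map φ) (by
      rw [le_principal_iff]
      exact Filter.mem_map.mpr (Filter.univ_mem' hφ))
  have hlim : ∀ a, Tendsto (fun i => averageFunctional S (μ i) (N i) a) U (𝓝 (ν a)) := fun a =>
    ((WeakDual.eval_continuous a).tendsto ν).comp hν
  refine ⟨WeakDual.toStrongDual ν, hlim, fun a => ?_⟩
  have h0 : Tendsto (fun i => ((N i : ℕ) : ℝ)⁻¹ * (2 * ‖a‖)) U (𝓝 0) := by
    simpa using (tendsto_inv_atTop_nhds_zero_nat.comp hN).mul_const (2 * ‖a‖)
  have h1 := squeeze_zero_norm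
    (fun i => norm_averageFunctional_map_sub_le hS (hμ i) (N i) a) h0
  exact sub_eq_zero.mp (tendsto_nhds_unique ((hlim (S a)).sub (hlim a)) h1)

end Average

/-- An ultrafilter limit of a bounded real function is at most its limsup along any coarser
filter. -/
theorem Ultrafilter.le_limsup_of_tendsto {I : Type*} {l : Filter I} (U : Ultrafilter I)
    (hU : (U : Filter I) ≤ l) {g : I → ℝ} {C c : ℝ} (hg : ∀ i, |g i| ≤ C)
    (hc : Tendsto g U (𝓝 c)) : c ≤ limsup g l := by
  rw [← hc.limsup_eq]
  exact limsup_le_limsup_of_le hU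
    (isBoundedUnder_of ⟨-C, fun i => (abs_le.mp (hg i)).1⟩).isCoboundedUnder_le
    (isBoundedUnder_of ⟨C, fun i => (abs_le.mp (hg i)).2⟩)

theorem abs_limsup_le {I : Type*} {l : Filter I} [l.NeBot] {g : I → ℝ} {C : ℝ}
    (hg : ∀ i, |g i| ≤ C) : |limsup g l| ≤ C := by
  have hlow : l.IsBoundedUnder (· ≥ ·) g := isBoundedUnder_of ⟨-C, fun i => (abs_le.mp (hg i)).1⟩
  have hup : l.IsBoundedUnder (· ≤ ·) g := isBoundedUnder_of ⟨C, fun i => (abs_le.mp (hg i)).2⟩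
  refine abs_le.mpr ⟨?_, ?_⟩
  · exact le_limsup_of_frequently_le
      (Eventually.of_forall fun i => (abs_le.mp (hg i)).1).frequently hup
  · exact limsup_le_of_le hlow.isCoboundedUnder_le
      (Eventually.of_forall fun i => (abs_le.mp (hg i)).2)



/-- **Van der Corput inequality on a unital C*-algebra.**
If `S` is a Markov–Schwarz operator on a unital C*-algebra `A` (i.e. `S 1 = 1` and
`(S x)⋆ (S x) ≤ S (x⋆ x)` for all `x`), `(N i)` is a net of positive integers indexed by a
directed set tending to infinity and `μ i` is a state on `A` for every `i`, then
`limsup_i |⟨(1/Nᵢ) ∑_{n<Nᵢ} Sⁿ x, μᵢ⟩|² ≤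
  liminf_J (1/J) ∑_{j=1}^J limsup_i (1/Nᵢ) ∑_{n<Nᵢ} Re ⟨Sⁿ((Sʲx)⋆ x), μᵢ⟩`. -/
theorem vdc_cstar {A : Type*} [NormedRing A] [StarRing A] [CStarRing A]
    [NormedAlgebra ℂ A] [CompleteSpace A] [StarModule ℂ A]
    [PartialOrder A] [StarOrderedRing A]
    (S : A →L[ℂ] A) (hS1 : S 1 = 1)
    (hSchwarz : ∀ x : A, star (S x) * S x ≤ S (star x * x))
    (x : A)
    {I : Type*} [Preorder I] [IsDirected I (· ≤ ·)] [Nonempty I]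
    (N : I → ℕ) (hNpos : ∀ i, 0 < N i) (hNtop : Tendsto N atTop atTop)
    (μ : I → A →L[ℂ] ℂ)
    (hμpos : ∀ i, ∀ a : A, 0 ≤ a → 0 ≤ μ i a)
    (hμnorm : ∀ i, ‖μ i‖ = 1) :
    limsup (fun i => ‖μ i ((N i : ℂ)⁻¹ • ∑ n ∈ range (N i), (S ^ n) x)‖ ^ 2) atTop ≤
      liminf (fun J : ℕ => (J : ℝ)⁻¹ * ∑ j ∈ Icc 1 J,
        limsup (fun i =>
          (N i : ℝ)⁻¹ * ∑ n ∈ range (N i),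
            (μ i ((S ^ n) (star ((S ^ j) x) * x))).re) atTop) atTop := by
  let _ : CStarAlgebra A := {}
  have hSn : ‖S‖ ≤ 1 := opNorm_le_one_of_schwarz S hS1 hSchwarz
  have hleft : ∀ i, μ i ((N i : ℂ)⁻¹ • ∑ n ∈ range (N i), (S ^ n) x) =
      averageFunctional S (μ i) (N i) x := fun i => by
    rw [averageFunctional_apply, map_smul, map_sum, smul_eq_mul]
  have hright : ∀ (i : I) (a : A), (N i : ℝ)⁻¹ * ∑ n ∈ range (N i), (μ i ((S ^ n) a)).re =
      (averageFunctional S (μ i) (N i) a).re := fun i a => by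
    rw [averageFunctional_apply, ← Complex.ofReal_natCast, ← Complex.ofReal_inv,
      Complex.re_ofReal_mul, Complex.re_sum]
  simp only [hleft, hright]
  have hbound : ∀ (i : I) (a : A), |(averageFunctional S (μ i) (N i) a).re| ≤ ‖a‖ := fun i a =>
    (Complex.abs_re_le_norm _).trans
      (norm_averageFunctional_apply_le hSn (hμnorm i).le (N i) a)
  have hcorr : ∀ (j : ℕ) (i : I),
      |(averageFunctional S (μ i) (N i) (star ((S ^ j) x) * x)).re| ≤ ‖x‖ * ‖x‖ := fun j i =>
    (hbound i _).trans <| (norm_mul_le _ _).trans <| by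
      rw [norm_star]
      gcongr
      exact norm_pow_apply_le hSn j x
  refine le_of_forall_lt_imp_le_of_dense fun c hc => ?_
  have hfreq := frequently_lt_of_lt_limsup
    (isBoundedUnder_of ⟨0, fun i => sq_nonneg _⟩ :
      IsBoundedUnder (· ≥ ·) atTop _).isCoboundedUnder_le hc
  have hne : (atTop ⊓ 𝓟 {i | c < ‖averageFunctional S (μ i) (N i) x‖ ^ 2}).NeBot :=
    frequently_mem_iff_neBot.mp hfreq
  let U := Ultrafilter.of (atTop ⊓ 𝓟 {i | c < ‖averageFunctional S (μ i) (N i) x‖ ^ 2})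
  have hU := Ultrafilter.of_le (atTop ⊓ 𝓟 {i | c < ‖averageFunctional S (μ i) (N i) x‖ ^ 2})
  have hUtop : (U : Filter I) ≤ atTop := hU.trans inf_le_left
  obtain ⟨ν, hν, hνS⟩ := exists_invariant_tendsto_averageFunctional U hSn
    (fun i => (hμnorm i).le) (hNtop.mono_left hUtop)
  have hνpos : ∀ a, 0 ≤ a → 0 ≤ ν a := fun a ha =>
    ge_of_tendsto' (hν a) fun i => by
      rw [averageFunctional_apply]
      refine mul_nonneg (by positivity) (sum_nonneg fun n hn => hμpos i _ ?_)
      clear hn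
      induction n with
      | zero => exact ha
      | succ n ih =>
        rw [pow_succ', mul_apply_eq_comp]
        exact map_nonneg_of_schwarz S hSchwarz ih
  have hν1 : (ν 1).re ≤ 1 := by
    refine le_of_tendsto' ((Complex.continuous_re.tendsto _).comp (hν 1)) fun i => ?_
    have : Nontrivial A := by
      by_contra h
      rw [not_nontrivial_iff_subsingleton] at h
      have := hμnorm i
      rw [Subsingleton.elim (μ i) 0] at this
      simp at this
    exact (le_abs_self _).trans ((hbound i 1).trans CStarRing.norm_one.le)
  have hcU : ∀ᶠ i in U, c < ‖averageFunctional S (μ i) (N i) x‖ ^ 2 :=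
    le_principal_iff.mp (hU.trans inf_le_right)
  have hcν : c ≤ ‖ν x‖ ^ 2 := ge_of_tendsto ((hν x).norm.pow 2) (hcU.mono fun i hi => hi.le)
  obtain ⟨L, hL, hlim⟩ := exists_tendsto_average_re_of_invariant S hS1 hSchwarz
    (.mk₀ ν.toLinearMap hνpos) hν1 hνS x
  refine (hcν.trans hL).trans ?_
  rw [← hlim.liminf_eq]
  refine liminf_le_liminf (Eventually.of_forall fun J => ?_) hlim.isBoundedUnder_ge
    (IsBoundedUnder.isCoboundedUnder_ge (isBoundedUnder_of ⟨‖x‖ * ‖x‖, fun J => ?_⟩))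
  · gcongr with j hj
    exact U.le_limsup_of_tendsto hUtop (hcorr j) ((Complex.continuous_re.tendsto _).comp (hν _))
  · rcases J.eq_zero_or_pos with rfl | hJ
    · simpa using mul_self_nonneg ‖x‖
    · rw [inv_mul_le_iff₀ (by positivity)]
      refine (sum_le_sum fun j _ => (abs_le.mp (abs_limsup_le (hcorr j))).2).trans ?_
      simp
end

section
/- Let S be a Markov operator on a commutative unital C*-algebra A and let T be an S-dominated bounded operator on a pre-Hilbert module E over A. Let x ∈ E, let (N_i)_{i∈I} be a net of positive integers indexed by a directed set I that tends to infinity, and let μ_i be a state on A for every i ∈ I. Then limsup_i ⟨|(1/N_i) Σ_{n=0}^{N_i−1} Tⁿ x|_A², μ_i⟩ ≤ liminf_{J→∞} (1/J) Σ_{j=1}^J limsup_i (1/N_i) Σ_{n=0}^{N_i−1} Re⟨Sⁿ (x | T^j x)_A, μ_i⟩. -/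
open Filter Finset
open scoped ComplexOrder Topology

namespace VanDerCorput

section MeanErgodic

variable {E : Type*} [AddCommGroup E] [Module ℂ E]

/-- The Cesàro mean `(1/n) ∑_{k<n} Tᵏ`. -/
noncomputable def cesaro (T : E →ₗ[ℂ] E) (n : ℕ) : E →ₗ[ℂ] E :=
  (n : ℂ)⁻¹ • ∑ k ∈ range n, T ^ k

lemma cesaro_apply (T : E →ₗ[ℂ] E) (n : ℕ) (y : E) :
    cesaro T n y = (n : ℂ)⁻¹ • ∑ k ∈ range n, (T ^ k) y := by
  simp [cesaro]

lemma cesaro_sub_map (T : E →ₗ[ℂ] E) (n : ℕ) (y : E) :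
    cesaro T n (y - T y) = (n : ℂ)⁻¹ • (y - (T ^ n) y) := by
  have h := Finset.sum_range_sub' (fun k => (T ^ k) y) n
  simp only [pow_zero, Module.End.one_apply] at h
  rw [cesaro_apply, ← h]
  simp [pow_succ]

lemma map_cesaro (T : E →ₗ[ℂ] E) (n : ℕ) (y : E) :
    T (cesaro T n y) = (n : ℂ)⁻¹ • ∑ k ∈ Icc 1 n, (T ^ k) y := by
  rw [cesaro_apply, map_smul, map_sum, ← Finset.Ico_add_one_right_eq_Icc,
    Finset.sum_Ico_eq_sum_range]
  simp [pow_succ', add_comm 1]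

lemma sub_cesaro (T : E →ₗ[ℂ] E) {n : ℕ} (hn : n ≠ 0) (y : E) :
    y - cesaro T n y = (n : ℂ)⁻¹ • ∑ k ∈ range n, (y - (T ^ k) y) := by
  rw [cesaro_apply, Finset.sum_sub_distrib, smul_sub, Finset.sum_const, card_range,
    ← Nat.cast_smul_eq_nsmul ℂ, inv_smul_smul₀ (Nat.cast_ne_zero.2 hn)]

/-- For a contraction on a Hilbert space, `‖(1/J) ∑_{j<J} Tʲ x‖²` and
`(1/J) ∑_{j=1}^J Re ⟪Tʲ x, x⟫` have the same limit. -/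
lemma exists_tendsto_norm_sq_cesaro_of_complete {H : Type*} [NormedAddCommGroup H]
    [InnerProductSpace ℂ H] [CompleteSpace H] (T : H →L[ℂ] H) (hT : ‖T‖ ≤ 1) (x : H) :
    ∃ L : ℝ, Tendsto (fun J : ℕ => ‖cesaro (T : H →ₗ[ℂ] H) J x‖ ^ 2) atTop (𝓝 L) ∧
      Tendsto (fun J : ℕ => (inner ℂ (T (cesaro (T : H →ₗ[ℂ] H) J x)) x).re) atTop (𝓝 L) := by
  set P := (T.eqLocus (1 : H →L[ℂ] H)).orthogonalProjectionOnto x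
  have h : Tendsto (fun J : ℕ => cesaro (T : H →ₗ[ℂ] H) J x) atTop (𝓝 (P : H)) := by
    refine (T.tendsto_birkhoffAverage_orthogonalProjection hT x).congr fun J => ?_
    simp only [birkhoffAverage, birkhoffSum, cesaro_apply, id, Module.End.pow_apply]
    rfl
  refine ⟨‖(P : H)‖ ^ 2, h.norm.pow 2, ?_⟩
  have hTP : T (P : H) = P := P.2
  have h1 := Complex.continuous_re.continuousAt.tendsto.comp
    (((T.continuous.tendsto _).comp h).inner (tendsto_const_nhds (x := x)) (𝕜 := ℂ))
  rw [hTP] at h1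
  have h2 : (inner ℂ (P : H) x).re = ‖(P : H)‖ ^ 2 := by
    have h3 := Submodule.starProjection_inner_eq_zero (K := T.eqLocus (1 : H →L[ℂ] H)) x P P.2
    rw [inner_eq_zero_symm, inner_sub_right, sub_eq_zero] at h3
    rw [norm_sq_eq_re_inner (𝕜 := ℂ), h3]
    rfl
  rw [← h2]
  exact h1

lemma exists_tendsto_norm_sq_cesaro {H : Type*} [SeminormedAddCommGroup H]
    [InnerProductSpace ℂ H] (T : H →ₗ[ℂ] H) (hT : ∀ y, ‖T y‖ ≤ ‖y‖) (x : H) :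
    ∃ L : ℝ, Tendsto (fun J : ℕ => ‖cesaro T J x‖ ^ 2) atTop (𝓝 L) ∧
      Tendsto (fun J : ℕ => (inner ℂ (T (cesaro T J x)) x).re) atTop (𝓝 L) := by
  let T' : H →L[ℂ] H := T.mkContinuous 1 (by simpa using hT)
  have hT' : ∀ y : H, T'.completion y = (T y : UniformSpace.Completion H) := fun y => by
    simp [T']
  have hnorm : ‖T'.completion‖ ≤ 1 := by
    refine ContinuousLinearMap.opNorm_le_bound _ zero_le_one fun y => ?_
    induction y using UniformSpace.Completion.induction_on with
    | hp => exact isClosed_le (by fun_prop) (by fun_prop)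
    | ih y => rw [hT']; simpa using hT y
  have hpow : ∀ (k : ℕ) (y : H), ((T'.completion : UniformSpace.Completion H →ₗ[ℂ] _) ^ k) y
      = ((T ^ k) y : UniformSpace.Completion H) := by
    intro k y
    induction k with
    | zero => simp
    | succ k ih => simp [pow_succ', ih, hT']
  have hces : ∀ J : ℕ, cesaro (T'.completion : UniformSpace.Completion H →ₗ[ℂ] _) J x
      = (cesaro T J x : UniformSpace.Completion H) := by
    intro J
    have := map_sum (UniformSpace.Completion.toComplL (𝕜 := ℂ) (E := H)) (fun k => (T ^ k) x)
      (range J)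
    simp only [UniformSpace.Completion.coe_toComplL] at this
    simp [cesaro_apply, hpow, UniformSpace.Completion.coe_smul, this]
  obtain ⟨L, h1, h2⟩ := exists_tendsto_norm_sq_cesaro_of_complete T'.completion hnorm x
  refine ⟨L, ?_, ?_⟩
  · simpa [hces] using h1
  · simpa only [hces, hT', UniformSpace.Completion.inner_coe] using h2

end MeanErgodic

section PositiveFunctional

variable {A : Type*} [CStarAlgebra A]

lemma pow_apply_one (S : A →ₗ[ℂ] A) (hS1 : S 1 = 1) (n : ℕ) : (S ^ n) 1 = 1 := by
  induction n with
  | zero => simp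
  | succ n ih => simp [pow_succ', ih, hS1]

lemma cesaro_one (S : A →ₗ[ℂ] A) (hS1 : S 1 = 1) {n : ℕ} (hn : n ≠ 0) : cesaro S n 1 = 1 := by
  simp [cesaro_apply, pow_apply_one S hS1, ← Nat.cast_smul_eq_nsmul ℂ, smul_smul, hn]

variable [PartialOrder A]

lemma pow_apply_nonneg (S : A →ₗ[ℂ] A) (hS : ∀ a, 0 ≤ a → 0 ≤ S a) (n : ℕ) {a : A} (ha : 0 ≤ a) :
    0 ≤ (S ^ n) a := by
  induction n with
  | zero => simpa
  | succ n ih => simpa [pow_succ'] using hS _ ih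

variable [StarOrderedRing A]

lemma norm_apply_le (φ : A →ₚ[ℂ] ℂ) (a : A) : ‖φ a‖ ≤ 4 * (‖φ 1‖ * ‖a‖) := by
  obtain ⟨y, hy_nonneg, hy_norm, hy⟩ := CStarAlgebra.exists_sum_four_nonneg a
  conv_lhs => rw [hy]
  simp only [map_sum, map_smul]
  refine (norm_sum_le _ _).trans ?_
  simp only [norm_smul, norm_pow, Complex.norm_I, one_pow, one_mul]
  refine (Finset.sum_le_sum (g := fun _ => ‖φ 1‖ * ‖a‖) fun i _ => ?_).trans (by simp)
  refine (φ.norm_apply_le_of_nonneg _ (hy_nonneg i)).trans ?_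
  gcongr
  exact hy_norm i

/-- A uniformly bounded family of positive functionals has a pointwise limit along any
ultrafilter. -/
lemma exists_ultralimit {I : Type*} (φ : I → A →ₚ[ℂ] ℂ) {M : ℝ} (hM : ∀ i, ‖φ i 1‖ ≤ M)
    (U : Ultrafilter I) : ∃ Φ : A →ₚ[ℂ] ℂ, ∀ a, Tendsto (fun i => φ i a) U (𝓝 (Φ a)) := by
  have h : ∀ a, ∃ l, Tendsto (fun i => φ i a) U (𝓝 l) := by
    intro a
    obtain ⟨l, -, hl⟩ := (isCompact_closedBall (0 : ℂ) (4 * (M * ‖a‖))).ultrafilter_le_nhds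
      (U.map fun i => φ i a) (by
        refine le_principal_iff.2 (Filter.mem_map.2 (Filter.univ_mem' fun i => ?_))
        simp only [Set.mem_preimage, mem_closedBall_zero_iff]
        refine (norm_apply_le _ _).trans ?_
        gcongr
        exact hM i)
    exact ⟨l, hl⟩
  choose Φ hΦ using h
  refine ⟨PositiveLinearMap.mk₀
    { toFun := Φ
      map_add' := fun a b => tendsto_nhds_unique (hΦ (a + b)) ?_
      map_smul' := fun c a => tendsto_nhds_unique (hΦ (c • a)) ?_ } fun a ha => ?_, hΦ⟩
  · simpa using (hΦ a).add (hΦ b)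
  · simpa using (hΦ a).const_mul c
  · exact ge_of_tendsto' (hΦ a) fun i => (φ i).map_nonneg ha

lemma cesaro_nonneg (S : A →ₗ[ℂ] A) (hS : ∀ a, 0 ≤ a → 0 ≤ S a) (n : ℕ) {a : A} (ha : 0 ≤ a) :
    0 ≤ cesaro S n a := by
  have h : cesaro S n a = (n : ℝ)⁻¹ • ∑ k ∈ range n, (S ^ k) a := by
    rw [cesaro_apply, ← Complex.coe_smul]
    simp
  rw [h]
  exact smul_nonneg (by positivity) (Finset.sum_nonneg fun k _ => pow_apply_nonneg S hS k ha)

/-- A positive functional composed with a positive map fixing `1` is controlled by its value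
at `1`. -/
lemma norm_comp_apply_le {S : A →ₗ[ℂ] A} (hS : ∀ a, 0 ≤ a → 0 ≤ S a) (hS1 : S 1 = 1)
    (φ : A →ₚ[ℂ] ℂ) {a : A} (ha : 0 ≤ a) : ‖φ (S a)‖ ≤ ‖φ 1‖ * ‖a‖ := by
  have h : ‖φ (S a)‖ ≤ ‖φ (S 1)‖ * ‖a‖ :=
    (φ.comp (PositiveLinearMap.mk₀ S hS)).norm_apply_le_of_nonneg a ha
  rwa [hS1] at h

end PositiveFunctional

section SemiInner

variable {A : Type*} [CStarAlgebra A] [PartialOrder A] [StarOrderedRing A]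
  {E : Type*} [AddCommGroup E] [Module ℂ E]

/-- An `A`-valued positive semidefinite sesquilinear form, linear in the first variable. -/
structure IsSemiInner (ip : E → E → A) : Prop where
  nonneg : ∀ y, 0 ≤ ip y y
  star_eq : ∀ y z, star (ip y z) = ip z y
  add_left : ∀ y z w, ip (y + z) w = ip y w + ip z w
  smul_left : ∀ (c : ℂ) y z, ip (c • y) z = c • ip y z

variable {ip : E → E → A}

/-- The scalar semi-inner product induced by an `A`-valued one and a positive functional. -/
noncomputable abbrev IsSemiInner.core (h : IsSemiInner ip) (φ : A →ₚ[ℂ] ℂ) :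
    PreInnerProductSpace.Core ℂ E where
  inner y z := φ (ip z y)
  conj_inner_symm y z := by rw [← h.star_eq y z, ← Complex.star_def, ← map_star]
  re_inner_nonneg y := (Complex.nonneg_iff.1 (φ.map_nonneg (h.nonneg y))).1
  add_left y z w := by
    rw [← h.star_eq (y + z), h.add_left, star_add, h.star_eq, h.star_eq, map_add]
  smul_left y z c := by
    rw [← h.star_eq (c • y), h.smul_left, star_smul, h.star_eq, map_smul]
    simp

/-- The seminorm `y ↦ √⟨|y|_A², φ⟩`. -/
noncomputable def IsSemiInner.seminorm (h : IsSemiInner ip) (φ : A →ₚ[ℂ] ℂ) : Seminorm ℂ E :=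
  letI := InnerProductSpace.Core.toSeminormedAddCommGroup (c := h.core φ)
  letI := InnerProductSpace.Core.toNormedSpace (c := h.core φ)
  normSeminorm ℂ E

lemma IsSemiInner.seminorm_apply (h : IsSemiInner ip) (φ : A →ₚ[ℂ] ℂ) (y : E) :
    h.seminorm φ y = √(φ (ip y y)).re := rfl

lemma IsSemiInner.seminorm_sq (h : IsSemiInner ip) (φ : A →ₚ[ℂ] ℂ) (y : E) :
    h.seminorm φ y ^ 2 = (φ (ip y y)).re := by
  rw [h.seminorm_apply, Real.sq_sqrt (Complex.nonneg_iff.1 (φ.map_nonneg (h.nonneg y))).1]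

lemma IsSemiInner.re_le (h : IsSemiInner ip) (φ : A →ₚ[ℂ] ℂ) (y z : E) :
    (φ (ip y z)).re ≤ h.seminorm φ z * h.seminorm φ y :=
  (Complex.re_le_norm _).trans
    (InnerProductSpace.Core.norm_inner_le_norm (c := h.core φ) z y)

/-- Mean ergodic limits for a linear map contracting the semi-inner product `φ ∘ ip`. -/
lemma IsSemiInner.exists_tendsto (h : IsSemiInner ip) (φ : A →ₚ[ℂ] ℂ) (T : E →ₗ[ℂ] E)
    (hT : ∀ y, (φ (ip (T y) (T y))).re ≤ (φ (ip y y)).re) (x : E) :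
    ∃ L : ℝ,
      Tendsto (fun J : ℕ => (φ (ip (cesaro T J x) (cesaro T J x))).re) atTop (𝓝 L) ∧
      Tendsto (fun J : ℕ => (J : ℝ)⁻¹ * ∑ j ∈ Icc 1 J, (φ (ip x ((T ^ j) x))).re)
        atTop (𝓝 L) := by
  let c := h.core φ
  let _ := InnerProductSpace.Core.toSeminormedAddCommGroup (c := c)
  let _ : InnerProductSpace ℂ E := InnerProductSpace.ofCore c
  obtain ⟨L, h1, h2⟩ := exists_tendsto_norm_sq_cesaro T (fun y => Real.sqrt_le_sqrt (hT y)) x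
  refine ⟨L, h1.congr fun J => h.seminorm_sq φ _, h2.congr fun J => ?_⟩
  have h3 : ∀ y, inner ℂ y x = φ (ip x y) := fun y => rfl
  rw [map_cesaro, inner_smul_left, sum_inner, map_inv₀, Complex.conj_natCast,
    ← Complex.ofReal_natCast, ← Complex.ofReal_inv, Complex.re_ofReal_mul, Complex.re_sum]
  simp only [h3]

variable {T : E →ₗ[ℂ] E} {S : A →ₗ[ℂ] A}

/-- `S`-domination passes to iterates. -/
lemma ip_pow_le (hS : ∀ a, 0 ≤ a → 0 ≤ S a)
    (hT : ∀ y, ip (T y) (T y) ≤ S (ip y y)) (n : ℕ) (y : E) :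
    ip ((T ^ n) y) ((T ^ n) y) ≤ (S ^ n) (ip y y) := by
  induction n with
  | zero => simp
  | succ n ih =>
    simp only [pow_succ', Module.End.mul_apply]
    refine (hT _).trans (sub_nonneg.1 ?_)
    rw [← map_sub]
    exact hS _ (sub_nonneg.2 ih)

lemma IsSemiInner.seminorm_pow_le (h : IsSemiInner ip) (hS : ∀ a, 0 ≤ a → 0 ≤ S a)
    (hS1 : S 1 = 1) (hT : ∀ y, ip (T y) (T y) ≤ S (ip y y)) (φ : A →ₚ[ℂ] ℂ) {M : ℝ}
    (hM : ‖φ 1‖ ≤ M) (n : ℕ) (y : E) :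
    h.seminorm φ ((T ^ n) y) ≤ √(M * ‖ip y y‖) := by
  rw [h.seminorm_apply]
  refine Real.sqrt_le_sqrt ?_
  have h1 := (Complex.le_def.1 (OrderHomClass.mono φ (ip_pow_le hS hT n y))).1
  refine h1.trans <| (Complex.re_le_norm _).trans <|
    (norm_comp_apply_le (fun a => pow_apply_nonneg S hS n) (pow_apply_one S hS1 n) φ
      (h.nonneg y)).trans ?_
  gcongr

/-- Convexity: `⟨|(1/n) ∑_{k<n} Tᵏ y|_A², φ⟩ ≤ (1/n) ∑_{k<n} ⟨Sᵏ |y|_A², φ⟩`. -/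
lemma IsSemiInner.seminorm_cesaro_sq_le (h : IsSemiInner ip) (hS : ∀ a, 0 ≤ a → 0 ≤ S a)
    (hT : ∀ y, ip (T y) (T y) ≤ S (ip y y)) (φ : A →ₚ[ℂ] ℂ) (n : ℕ) (y : E) :
    h.seminorm φ (cesaro T n y) ^ 2 ≤ (φ (cesaro S n (ip y y))).re := by
  rcases Nat.eq_zero_or_pos n with rfl | hn
  · simp [cesaro_apply]
  have h1 : h.seminorm φ (cesaro T n y) ≤ (n : ℝ)⁻¹ * ∑ k ∈ range n, h.seminorm φ ((T ^ k) y) := by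
    rw [cesaro_apply, map_smul_eq_mul, norm_inv, Complex.norm_natCast]
    gcongr
    exact Finset.le_sum_of_subadditive _ (map_zero _).le (map_add_le_add _) _ _
  have h2 : (φ (cesaro S n (ip y y))).re
      = (n : ℝ)⁻¹ * ∑ k ∈ range n, (φ ((S ^ k) (ip y y))).re := by
    rw [cesaro_apply, map_smul, map_sum, smul_eq_mul, ← Complex.ofReal_natCast,
      ← Complex.ofReal_inv, Complex.re_ofReal_mul, Complex.re_sum]
  have h3 : ∀ k, h.seminorm φ ((T ^ k) y) ^ 2 ≤ (φ ((S ^ k) (ip y y))).re := fun k => by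
    rw [h.seminorm_sq]
    exact (Complex.le_def.1 (OrderHomClass.mono φ (ip_pow_le hS hT k y))).1
  have hn' : (0 : ℝ) < n := by exact_mod_cast hn
  calc h.seminorm φ (cesaro T n y) ^ 2
      ≤ ((n : ℝ)⁻¹ * ∑ k ∈ range n, h.seminorm φ ((T ^ k) y)) ^ 2 := by gcongr
    _ = (n : ℝ)⁻¹ ^ 2 * (∑ k ∈ range n, h.seminorm φ ((T ^ k) y)) ^ 2 := by ring
    _ ≤ (n : ℝ)⁻¹ ^ 2 * (n * ∑ k ∈ range n, h.seminorm φ ((T ^ k) y) ^ 2) := by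
        gcongr
        simpa using sq_sum_le_card_mul_sum_sq (s := range n)
          (f := fun k => h.seminorm φ ((T ^ k) y))
    _ = (n : ℝ)⁻¹ * ∑ k ∈ range n, h.seminorm φ ((T ^ k) y) ^ 2 := by field_simp
    _ ≤ _ := by
        rw [h2]
        gcongr with k
        exact h3 k

/-- Cesàro means along `N → ∞` do not distinguish `y` from `Tʲ y`. -/
lemma IsSemiInner.tendsto_seminorm_cesaro_sub_pow (h : IsSemiInner ip)
    (hS : ∀ a, 0 ≤ a → 0 ≤ S a) (hS1 : S 1 = 1) (hT : ∀ y, ip (T y) (T y) ≤ S (ip y y))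
    {I : Type*} {l : Filter I} {N : I → ℕ} (hN : Tendsto N l atTop) (μ : I → A →ₚ[ℂ] ℂ) {M : ℝ}
    (hM : ∀ i, ‖μ i 1‖ ≤ M) (y : E) (j : ℕ) :
    Tendsto (fun i => h.seminorm (μ i) (cesaro T (N i) (y - (T ^ j) y))) l (𝓝 0) := by
  have hstep : ∀ z, Tendsto (fun i => h.seminorm (μ i) (cesaro T (N i) (z - T z))) l (𝓝 0) := by
    intro z
    have hlim : Tendsto (fun i => (N i : ℝ)⁻¹ * (2 * √(M * ‖ip z z‖))) l (𝓝 0) := by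
      simpa using (tendsto_inv_atTop_nhds_zero_nat.comp hN).mul_const (2 * √(M * ‖ip z z‖))
    refine squeeze_zero (fun i => apply_nonneg _ _) (fun i => ?_) hlim
    rw [cesaro_sub_map, map_smul_eq_mul, norm_inv, Complex.norm_natCast]
    gcongr
    refine (map_sub_le_add _ _ _).trans ?_
    have h0 := h.seminorm_pow_le hS hS1 hT (μ i) (hM i) 0 z
    have h1 := h.seminorm_pow_le hS hS1 hT (μ i) (hM i) (N i) z
    simp only [pow_zero, Module.End.one_apply] at h0
    linarith
  induction j with
  | zero => simpa using tendsto_const_nhds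
  | succ j ih =>
    have hlim := ih.add (hstep ((T ^ j) y))
    rw [add_zero] at hlim
    refine squeeze_zero (fun i => apply_nonneg _ _) (fun i => ?_) hlim
    rw [← sub_add_sub_cancel y ((T ^ j) y), map_add, pow_succ', Module.End.mul_apply]
    exact map_add_le_add _ _ _

lemma IsSemiInner.tendsto_seminorm_cesaro_sub_cesaro (h : IsSemiInner ip)
    (hS : ∀ a, 0 ≤ a → 0 ≤ S a) (hS1 : S 1 = 1) (hT : ∀ y, ip (T y) (T y) ≤ S (ip y y))
    {I : Type*} {l : Filter I} {N : I → ℕ} (hN : Tendsto N l atTop) (μ : I → A →ₚ[ℂ] ℂ) {M : ℝ}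
    (hM : ∀ i, ‖μ i 1‖ ≤ M) (y : E) {J : ℕ} (hJ : J ≠ 0) :
    Tendsto (fun i => h.seminorm (μ i) (cesaro T (N i) (y - cesaro T J y))) l (𝓝 0) := by
  have hlim : Tendsto (fun i => (J : ℝ)⁻¹ *
      ∑ j ∈ range J, h.seminorm (μ i) (cesaro T (N i) (y - (T ^ j) y))) l (𝓝 0) := by
    simpa using (tendsto_finsetSum (range J) fun j _ =>
      h.tendsto_seminorm_cesaro_sub_pow hS hS1 hT hN μ hM y j).const_mul (J : ℝ)⁻¹
  refine squeeze_zero (fun i => apply_nonneg _ _) (fun i => ?_) hlim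
  rw [sub_cesaro T hJ, map_smul, map_sum, map_smul_eq_mul, norm_inv, Complex.norm_natCast]
  gcongr
  exact Finset.le_sum_of_subadditive _ (map_zero _).le (map_add_le_add _) _ _

/-- Van der Corput inequality along an ultrafilter: every limit of the squared seminorms of the
Cesàro means is at most the mean ergodic limit attached to a limit functional. -/
lemma IsSemiInner.exists_ultralimit_le (h : IsSemiInner ip)
    (hS : ∀ a, 0 ≤ a → 0 ≤ S a) (hS1 : S 1 = 1) (hT : ∀ y, ip (T y) (T y) ≤ S (ip y y))
    {I : Type*} (U : Ultrafilter I) {N : I → ℕ} (hNpos : ∀ i, 0 < N i)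
    (hN : Tendsto N U atTop) (μ : I → A →ₚ[ℂ] ℂ) {M : ℝ} (hM : ∀ i, ‖μ i 1‖ ≤ M) (x : E) {b : ℝ}
    (hb : ∀ᶠ i in U, b ≤ h.seminorm (μ i) (cesaro T (N i) x) ^ 2) :
    ∃ (Φ : A →ₚ[ℂ] ℂ) (L : ℝ),
      (∀ a, Tendsto (fun i => μ i (cesaro S (N i) a)) U (𝓝 (Φ a))) ∧ b ≤ L ∧
      Tendsto (fun J : ℕ => (J : ℝ)⁻¹ * ∑ j ∈ Icc 1 J, (Φ (ip x ((T ^ j) x))).re)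
        atTop (𝓝 L) := by
  obtain ⟨Φ, hΦ⟩ := exists_ultralimit
    (fun i => (μ i).comp (PositiveLinearMap.mk₀ (cesaro S (N i)) fun _ => cesaro_nonneg S hS _))
    (M := M) (fun i => by
      change ‖μ i (cesaro S (N i) 1)‖ ≤ M
      rw [cesaro_one S hS1 (hNpos i).ne']
      exact hM i) U
  replace hΦ : ∀ a, Tendsto (fun i => μ i (cesaro S (N i) a)) U (𝓝 (Φ a)) := hΦ
  have hinv : ∀ a, 0 ≤ a → Φ (S a) = Φ a := by
    intro a ha
    have hlim : Tendsto (fun i => μ i (cesaro S (N i) (a - S a))) U (𝓝 0) := by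
      have hbd : Tendsto (fun i => (N i : ℝ)⁻¹ * (2 * (M * ‖a‖))) U (𝓝 0) := by
        simpa using (tendsto_inv_atTop_nhds_zero_nat.comp hN).mul_const (2 * (M * ‖a‖))
      refine squeeze_zero_norm (fun i => ?_) hbd
      rw [cesaro_sub_map, map_smul, norm_smul, norm_inv, Complex.norm_natCast, map_sub]
      gcongr
      have hpow : ∀ n, ‖μ i ((S ^ n) a)‖ ≤ M * ‖a‖ := fun n =>
        (norm_comp_apply_le (fun a => pow_apply_nonneg S hS n) (pow_apply_one S hS1 n) (μ i)
          ha).trans (by gcongr; exact hM i)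
      have h0 := hpow 0
      simp only [pow_zero, Module.End.one_apply] at h0
      linarith [norm_sub_le (μ i a) (μ i ((S ^ N i) a)), hpow (N i)]
    have := tendsto_nhds_unique (hΦ (a - S a)) hlim
    rw [map_sub, sub_eq_zero] at this
    exact this.symm
  obtain ⟨L, hL1, hL2⟩ := h.exists_tendsto Φ T (fun y => by
    rw [← hinv _ (h.nonneg y)]
    exact (Complex.le_def.1 (OrderHomClass.mono Φ (hT y))).1) x
  refine ⟨Φ, L, hΦ, ?_, hL2⟩
  refine ge_of_tendsto hL1 ((eventually_ne_atTop 0).mono fun J hJ => ?_)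
  set y := cesaro T J x
  have hnn : 0 ≤ (Φ (ip y y)).re := (Complex.nonneg_iff.1 (Φ.map_nonneg (h.nonneg y))).1
  have hsum : Tendsto (fun i => (√(μ i (cesaro S (N i) (ip y y))).re +
      h.seminorm (μ i) (cesaro T (N i) (x - y))) ^ 2) U (𝓝 ((√(Φ (ip y y)).re + 0) ^ 2)) := by
    refine Tendsto.pow (Tendsto.add ?_ ?_) 2
    · exact ((Complex.continuous_re.tendsto _).comp (hΦ (ip y y))).sqrt
    · exact h.tendsto_seminorm_cesaro_sub_cesaro hS hS1 hT hN μ hM x hJ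
  rw [add_zero, Real.sq_sqrt hnn] at hsum
  refine ge_of_tendsto hsum (hb.mono fun i hi => hi.trans ?_)
  gcongr
  calc h.seminorm (μ i) (cesaro T (N i) x)
      = h.seminorm (μ i) (cesaro T (N i) y + cesaro T (N i) (x - y)) := by
        rw [← map_add, add_sub_cancel]
    _ ≤ h.seminorm (μ i) (cesaro T (N i) y) + h.seminorm (μ i) (cesaro T (N i) (x - y)) :=
        map_add_le_add _ _ _
    _ ≤ _ := by
        gcongr
        exact Real.le_sqrt_of_sq_le (h.seminorm_cesaro_sq_le hS hT (μ i) (N i) y)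

/-- The van der Corput inequality for positive functionals of bounded mass. -/
theorem IsSemiInner.limsup_le_liminf (h : IsSemiInner ip)
    (hS : ∀ a, 0 ≤ a → 0 ≤ S a) (hS1 : S 1 = 1) (hT : ∀ y, ip (T y) (T y) ≤ S (ip y y))
    {I : Type*} {l : Filter I} [l.NeBot] {N : I → ℕ} (hNpos : ∀ i, 0 < N i)
    (hN : Tendsto N l atTop) (μ : I → A →ₚ[ℂ] ℂ) {M : ℝ} (hM : ∀ i, ‖μ i 1‖ ≤ M) (x : E) :
    limsup (fun i => (μ i (ip (cesaro T (N i) x) (cesaro T (N i) x))).re) l ≤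
      liminf (fun J : ℕ => (J : ℝ)⁻¹ * ∑ j ∈ Icc 1 J,
        limsup (fun i => (μ i (cesaro S (N i) (ip x ((T ^ j) x)))).re) l) atTop := by
  -- `φ i` is the average of `μ i` along `S`.
  let φ : I → A →ₚ[ℂ] ℂ := fun i =>
    (μ i).comp (PositiveLinearMap.mk₀ (cesaro S (N i)) fun _ => cesaro_nonneg S hS _)
  have hφM : ∀ i, ‖φ i 1‖ ≤ M := fun i => by
    change ‖μ i (cesaro S (N i) 1)‖ ≤ M
    rw [cesaro_one S hS1 (hNpos i).ne']
    exact hM i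
  have hφ : ∀ i a, μ i (cesaro S (N i) a) = φ i a := fun _ _ => rfl
  have hbound : ∀ j i, |(φ i (ip x ((T ^ j) x))).re| ≤ 4 * (M * ‖ip x ((T ^ j) x)‖) := by
    intro j i
    refine (Complex.abs_re_le_norm _).trans ((norm_apply_le _ _).trans ?_)
    gcongr
    exact hφM i
  have hle : ∀ j i, (φ i (ip x ((T ^ j) x))).re ≤ M * ‖ip x x‖ := by
    intro j i
    have hMnn : 0 ≤ M := (norm_nonneg _).trans (hM i)
    have h0 := h.seminorm_pow_le hS hS1 hT (φ i) (hφM i) 0 x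
    have h1 := h.seminorm_pow_le hS hS1 hT (φ i) (hφM i) j x
    rw [pow_zero, Module.End.one_apply] at h0
    calc (φ i (ip x ((T ^ j) x))).re
        ≤ h.seminorm (φ i) ((T ^ j) x) * h.seminorm (φ i) x := h.re_le _ _ _
      _ ≤ √(M * ‖ip x x‖) * √(M * ‖ip x x‖) := by gcongr
      _ = M * ‖ip x x‖ := Real.mul_self_sqrt (by positivity)
  simp only [hφ]
  have hbelow : ∀ j, IsBoundedUnder (· ≥ ·) l fun i => (φ i (ip x ((T ^ j) x))).re := fun j =>
    isBoundedUnder_of ⟨_, fun i => (abs_le.1 (hbound j i)).1⟩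
  have habove : ∀ j, IsBoundedUnder (· ≤ ·) l fun i => (φ i (ip x ((T ^ j) x))).re := fun j =>
    isBoundedUnder_of ⟨_, fun i => hle j i⟩
  have hlimsup : ∀ j, limsup (fun i => (φ i (ip x ((T ^ j) x))).re) l ≤ M * ‖ip x x‖ := fun j =>
    limsup_le_of_le (hbelow j).isCoboundedUnder_le (Eventually.of_forall fun i => hle j i)
  have hMnn : 0 ≤ M := (norm_nonneg _).trans (hM (l.nonempty_of_neBot).some)
  have hcob : IsCoboundedUnder (· ≥ ·) atTop fun J : ℕ => (J : ℝ)⁻¹ * ∑ j ∈ Icc 1 J,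
      limsup (fun i => (φ i (ip x ((T ^ j) x))).re) l := by
    refine IsBoundedUnder.isCoboundedUnder_ge (isBoundedUnder_of ⟨M * ‖ip x x‖, fun J => ?_⟩)
    calc (J : ℝ)⁻¹ * ∑ j ∈ Icc 1 J, limsup (fun i => (φ i (ip x ((T ^ j) x))).re) l
        ≤ (J : ℝ)⁻¹ * ∑ j ∈ Icc 1 J, M * ‖ip x x‖ := by
          gcongr with j
          exact hlimsup j
      _ = (J : ℝ)⁻¹ * J * (M * ‖ip x x‖) := by simp [mul_assoc]
      _ ≤ M * ‖ip x x‖ := mul_le_of_le_one_left (by positivity) inv_mul_le_one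
  refine le_of_forall_lt_imp_le_of_dense fun b hb => ?_
  have hfreq := frequently_lt_of_lt_limsup (IsBoundedUnder.isCoboundedUnder_le
    (isBoundedUnder_of ⟨0, fun i => h.seminorm_sq (μ i) _ ▸ sq_nonneg _⟩)) hb
  obtain ⟨U, hU⟩ := Ultrafilter.exists_le (h := frequently_mem_iff_neBot.1 hfreq)
  have hUl : (U : Filter I) ≤ l := hU.trans inf_le_left
  obtain ⟨Φ, L, hΦ, hbL, hL⟩ := h.exists_ultralimit_le hS hS1 hT U hNpos (hN.mono_left hUl) μ hM x
    (b := b) (by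
      filter_upwards [le_principal_iff.1 (hU.trans inf_le_right)] with i hi
      rw [h.seminorm_sq]
      exact le_of_lt hi)
  have hΦle : ∀ j, (Φ (ip x ((T ^ j) x))).re
      ≤ limsup (fun i => (φ i (ip x ((T ^ j) x))).re) l := by
    intro j
    have hlim : Tendsto (fun i => (φ i (ip x ((T ^ j) x))).re) U (𝓝 (Φ (ip x ((T ^ j) x))).re) :=
      (Complex.continuous_re.tendsto _).comp (hΦ _)
    rw [← hlim.limsup_eq]
    exact limsup_le_limsup_of_le hUl hlim.isBoundedUnder_ge.isCoboundedUnder_le (habove j)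
  rw [← hL.liminf_eq] at hbL
  refine hbL.trans (liminf_le_liminf (Eventually.of_forall fun J => ?_) hL.isBoundedUnder_ge hcob)
  gcongr with j
  exact hΦle j

end SemiInner

end VanDerCorput

/-- **Van der Corput inequality on pre-Hilbert modules.**
Let `S` be a Markov operator on a commutative unital C*-algebra `A` and `T` an `S`-dominated
bounded operator on a pre-Hilbert module `E` over `A` with `A`-valued inner product `ip`
(note `|y|_A² = ip y y`, so `S`-domination reads `ip (T y) (T y) ≤ S (ip y y)` and boundedness
of `T` reads `‖ip (T y) (T y)‖ ≤ C * ‖ip y y‖`, i.e. `‖T y‖ ≤ √C ‖y‖`).  Let `(N i)` be a net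
of positive integers indexed by a directed set tending to infinity and `μ i` a state on `A`
for each `i`.  Then
`limsup_i ⟨|(1/Nᵢ) ∑_{n<Nᵢ} Tⁿ x|_A², μᵢ⟩ ≤
  liminf_J (1/J) ∑_{j=1}^J limsup_i (1/Nᵢ) ∑_{n<Nᵢ} Re ⟨Sⁿ (x | Tʲ x)_A, μᵢ⟩`. -/
theorem vdc_module {A : Type*} [NormedCommRing A] [StarRing A] [CStarRing A]
    [NormedAlgebra ℂ A] [CompleteSpace A] [StarModule ℂ A]
    [PartialOrder A] [StarOrderedRing A]
    (S : A →L[ℂ] A) (hS1 : S 1 = 1) (hSpos : ∀ a : A, 0 ≤ a → 0 ≤ S a)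
    {E : Type*} [AddCommGroup E] [Module ℂ E] [Module A E] [IsScalarTower ℂ A E]
    (ip : E → E → A)
    (ip_nonneg : ∀ y : E, 0 ≤ ip y y)
    (ip_definite : ∀ y : E, ip y y = 0 → y = 0)
    (ip_star : ∀ y z : E, star (ip y z) = ip z y)
    (ip_add : ∀ y z w : E, ip (y + z) w = ip y w + ip z w)
    (ip_smul : ∀ (a : A) (y z : E), ip (a • y) z = a * ip y z)
    (T : E →ₗ[ℂ] E)
    (hTbdd : ∃ C : ℝ, 0 ≤ C ∧ ∀ y : E, ‖ip (T y) (T y)‖ ≤ C * ‖ip y y‖)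
    (hTdom : ∀ y : E, ip (T y) (T y) ≤ S (ip y y))
    (x : E)
    {I : Type*} [Preorder I] [IsDirected I (· ≤ ·)] [Nonempty I]
    (N : I → ℕ) (hNpos : ∀ i, 0 < N i) (hNtop : Tendsto N atTop atTop)
    (μ : I → A →L[ℂ] ℂ)
    (hμpos : ∀ i, ∀ a : A, 0 ≤ a → 0 ≤ μ i a)
    (hμnorm : ∀ i, ‖μ i‖ = 1) :
    limsup (fun i =>
        (μ i (ip ((N i : ℂ)⁻¹ • ∑ n ∈ range (N i), (T ^ n) x)
                 ((N i : ℂ)⁻¹ • ∑ n ∈ range (N i), (T ^ n) x))).re) atTop ≤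
      liminf (fun J : ℕ => (J : ℝ)⁻¹ * ∑ j ∈ Icc 1 J,
        limsup (fun i =>
          (N i : ℝ)⁻¹ * ∑ n ∈ range (N i),
            (μ i ((S ^ n) (ip x ((T ^ j) x)))).re) atTop) atTop := by
  let _ : CommCStarAlgebra A := {}
  have h : VanDerCorput.IsSemiInner ip :=
    ⟨ip_nonneg, ip_star, ip_add, fun c y z => by
      rw [← one_smul A y, ← smul_assoc, ip_smul, ip_smul, one_mul, smul_one_mul]⟩
  have hSpow : ∀ (n : ℕ) (a : A), (S ^ n) a = ((S : A →ₗ[ℂ] A) ^ n) a := fun n a => by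
    induction n with
    | zero => rfl
    | succ n ih =>
      rw [pow_succ', pow_succ', Module.End.mul_apply, ← ih]
      rfl
  have hμ1 : ∀ i, ‖μ i 1‖ ≤ ‖(1 : A)‖ := fun i => by
    simpa [hμnorm i] using (μ i).le_opNorm 1
  have hvdc := h.limsup_le_liminf (T := T) (S := (S : A →ₗ[ℂ] A)) hSpos hS1 hTdom hNpos hNtop
    (fun i => PositiveLinearMap.mk₀ (μ i : A →ₗ[ℂ] ℂ) (hμpos i)) hμ1 x
  have hμre : ∀ (i : I) (a : A), (μ i (VanDerCorput.cesaro (S : A →ₗ[ℂ] A) (N i) a)).re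
      = (N i : ℝ)⁻¹ * ∑ n ∈ range (N i), (μ i ((S ^ n) a)).re := fun i a => by
    rw [VanDerCorput.cesaro_apply, map_smul, map_sum, smul_eq_mul, ← Complex.ofReal_natCast,
      ← Complex.ofReal_inv, Complex.re_ofReal_mul, Complex.re_sum]
    simp only [hSpow]
  simp only [← hμre, ← VanDerCorput.cesaro_apply]
  exact hvdc
end

section
/- Let 𝒮 be a right cancellative semigroup, let (F_i)_{i∈I} and (G_j)_{j∈J} be right Følner nets for 𝒮, let A be a unital C*-algebra, let S : 𝒮 → 𝓛(A) be a semigroup representation such that S_t is a Markov–Schwarz operator for every t ∈ 𝒮, and let μ_i be a state on A for every i ∈ I. Then for every x ∈ A: limsup_i |⟨(1/|F_i|) Σ_{t∈F_i} S_t x, μ_i⟩|² ≤ liminf_j (1/|G_j|) Σ_{s∈G_j} limsup_i (1/|F_i|) Σ_{t∈F_i} Re⟨S_t((S_s x)* x), μ_i⟩. -/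
open Filter Finset
open scoped ComplexOrder

/-- Sums of a bounded function over two finite sets differ by at most the bound times the
cardinality of the symmetric difference. -/
lemma norm_sum_sub_sum_le_card_symmDiff {α E : Type*} [DecidableEq α] [SeminormedAddCommGroup E]
    (s t : Finset α) (f : α → E) {C : ℝ} (hf : ∀ a, ‖f a‖ ≤ C) :
    ‖∑ a ∈ s, f a - ∑ a ∈ t, f a‖ ≤ (symmDiff s t).card * C := by
  have hcard : (symmDiff s t).card = (s \ t).card + (t \ s).card :=
    card_union_of_disjoint disjoint_sdiff_sdiff
  rw [← sum_sdiff_sub_sum_sdiff, hcard, Nat.cast_add, add_mul]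
  refine (norm_sub_le _ _).trans (add_le_add ?_ ?_) <;>
  · refine (norm_sum_le_of_le _ fun a _ => hf a).trans ?_
    simp

/-- Averages along a right Følner net are asymptotically invariant under right translation. -/
lemma tendsto_average_translate_sub {𝒮 J E : Type*} [Semigroup 𝒮] [DecidableEq 𝒮]
    [SeminormedAddCommGroup E] [NormedSpace ℂ E] {l : Filter J} {G : J → Finset 𝒮} {s : 𝒮}
    (hrc : ∀ r t : 𝒮, r * s = t * s → r = t)
    (hG : Tendsto (fun j => ((symmDiff ((G j).image (· * s)) (G j)).card : ℝ) / (G j).card)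
      l (nhds 0))
    (f : J → 𝒮 → E) {C : ℝ} (hf : ∀ j t, ‖f j t‖ ≤ C) :
    Tendsto (fun j => ((G j).card : ℂ)⁻¹ • ∑ t ∈ G j, (f j (t * s) - f j t)) l (nhds 0) := by
  refine squeeze_zero_norm (fun j => ?_) (by simpa using hG.mul_const C)
  have himage : ∑ t ∈ G j, f j (t * s) = ∑ r ∈ (G j).image (· * s), f j r :=
    (sum_image fun r _ t _ h => hrc r t h).symm
  rw [sum_sub_distrib, himage, norm_smul, norm_inv, Complex.norm_natCast, div_eq_inv_mul,
    mul_assoc]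
  gcongr
  exact norm_sum_sub_sum_le_card_symmDiff _ _ _ (hf j)

/-- For a semigroup of contractions on a Hilbert space whose adjoints fix a vector `e` of norm at
most one, the averages of `⟨T s x, x⟩` along a right Følner net converge to a number which is at
least `|⟨x, e⟩|²`. -/
lemma exists_tendsto_average_inner {𝒮 J H : Type*} [Semigroup 𝒮] [DecidableEq 𝒮]
    [NormedAddCommGroup H] [InnerProductSpace ℂ H] [CompleteSpace H]
    (hrc : ∀ r s t : 𝒮, r * t = s * t → r = s)
    {l : Filter J} [l.NeBot] {G : J → Finset 𝒮} (hGne : ∀ j, (G j).Nonempty)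
    (hG : ∀ s : 𝒮,
      Tendsto (fun j => ((symmDiff ((G j).image (· * s)) (G j)).card : ℝ) / (G j).card)
        l (nhds 0))
    (T : 𝒮 → H →L[ℂ] H) (hT : ∀ s t v, T (s * t) v = T s (T t v)) (hT1 : ∀ s v, ‖T s v‖ ≤ ‖v‖)
    (e : H) (he : ‖e‖ ≤ 1) (hTe : ∀ s v, inner ℂ (T s v) e = inner ℂ v e) (x : H) :
    ∃ c : ℝ, ‖(inner ℂ x e : ℂ)‖ ^ 2 ≤ c ∧
      Tendsto (fun j => ((G j).card : ℝ)⁻¹ * ∑ s ∈ G j, (inner ℂ (T s x) x : ℂ).re) l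
        (nhds c) := by
  have hcard : ∀ j, ((G j).card : ℂ) ≠ 0 := fun j => by simpa using (hGne j).ne_empty
  set M : J → H →L[ℂ] H := fun j => ((G j).card : ℂ)⁻¹ • ∑ s ∈ G j, T s with hM
  have hMv : ∀ j v, M j v = ((G j).card : ℂ)⁻¹ • ∑ s ∈ G j, T s v := by
    intro j v
    simp [hM]
  have hM1 : ∀ j v, ‖M j v‖ ≤ ‖v‖ := by
    intro j v
    have hpos : (0 : ℝ) < (G j).card := by exact_mod_cast (hGne j).card_pos
    rw [hMv, norm_smul, norm_inv, Complex.norm_natCast, inv_mul_le_iff₀ hpos]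
    refine (norm_sum_le_of_le _ fun s _ => hT1 s v).trans ?_
    simp
  let N : Submodule ℂ H :=
    { carrier := {v | Tendsto (fun j => M j v) l (nhds 0)}
      add_mem' := fun {a b} ha hb => by
        have := Tendsto.add ha hb
        simpa using this
      zero_mem' := by simp
      smul_mem' := fun c a ha => by
        have := Tendsto.const_smul ha c
        simpa using this }
  have hNmem : ∀ v, v ∈ N ↔ Tendsto (fun j => M j v) l (nhds 0) := fun v => Iff.rfl
  have hNclosed : IsClosed (N : Set H) := by
    refine isClosed_of_closure_subset fun v hv => ?_
    rw [SetLike.mem_coe, hNmem, NormedAddGroup.tendsto_nhds_zero]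
    intro ε hε
    obtain ⟨n, hn, hvn⟩ := Metric.mem_closure_iff.1 hv (ε / 2) (half_pos hε)
    filter_upwards [NormedAddGroup.tendsto_nhds_zero.1 ((hNmem n).1 hn) (ε / 2) (half_pos hε)]
      with j hj
    have h1 : M j v = M j (v - n) + M j n := by rw [← map_add, sub_add_cancel]
    rw [dist_eq_norm] at hvn
    rw [h1]
    linarith [norm_add_le (M j (v - n)) (M j n), hM1 j (v - n)]
  have hNsub : ∀ s v, T s v - v ∈ N := by
    intro s v
    rw [hNmem]
    have h := tendsto_average_translate_sub (fun r t h => hrc r t s h) (hG s)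
      (fun _ t => T t v) (fun _ t => hT1 t v)
    refine h.congr fun j => ?_
    simp only [hMv, hT, map_sub]
  have hfix : ∀ w ∈ Nᗮ, ∀ s, T s w = w := by
    intro w hw s
    have h0 : inner ℂ (T s w - w) w = 0 := (Submodule.mem_orthogonal _ _).1 hw _ (hNsub s w)
    have h1 : RCLike.re (inner ℂ (T s w) w : ℂ) = ‖w‖ ^ 2 := by
      rw [inner_sub_left, sub_eq_zero] at h0
      rw [h0, inner_self_eq_norm_sq]
    have h2 : ‖T s w - w‖ ^ 2 ≤ 0 := by
      rw [norm_sub_sq (𝕜 := ℂ), h1]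
      nlinarith [hT1 s w, norm_nonneg (T s w), norm_nonneg w]
    have h3 : ‖T s w - w‖ = 0 := by nlinarith [norm_nonneg (T s w - w)]
    exact sub_eq_zero.1 (norm_eq_zero.1 h3)
  have : CompleteSpace N := hNclosed.completeSpace_coe
  obtain ⟨n, hn, w, hw, rfl⟩ := N.exists_add_mem_mem_orthogonal x
  have hMw : ∀ j, M j w = w := by
    intro j
    rw [hMv, sum_congr rfl fun s _ => hfix w hw s, sum_const, ← Nat.cast_smul_eq_nsmul ℂ,
      smul_smul, inv_mul_cancel₀ (hcard j), one_smul]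
  have hne : inner ℂ n e = (0 : ℂ) := by
    have h1 : ∀ j, inner ℂ (M j n) e = (inner ℂ n e : ℂ) := by
      intro j
      rw [hMv, inner_smul_left, sum_inner, sum_congr rfl fun s _ => hTe s n, sum_const,
        nsmul_eq_mul]
      simp [hcard j]
    have h2 : Tendsto (fun j => (inner ℂ (M j n) e : ℂ)) l (nhds (inner ℂ (0 : H) e)) :=
      ((hNmem n).1 hn).inner tendsto_const_nhds
    simp only [h1, inner_zero_left] at h2
    exact tendsto_nhds_unique tendsto_const_nhds h2
  refine ⟨‖w‖ ^ 2, ?_, ?_⟩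
  · rw [inner_add_left, hne, zero_add]
    gcongr
    exact (norm_inner_le_norm w e).trans (mul_le_of_le_one_right (norm_nonneg _) he)
  · have hlim : Tendsto (fun j => M j (n + w)) l (nhds w) := by
      simpa [hMw] using ((hNmem n).1 hn).add_const w
    have h2 : Tendsto (fun j => (inner ℂ (M j (n + w)) (n + w) : ℂ).re) l
        (nhds (inner ℂ w (n + w) : ℂ).re) :=
      (Complex.continuous_re.tendsto _).comp (hlim.inner tendsto_const_nhds)
    have h3 : (inner ℂ w (n + w) : ℂ).re = ‖w‖ ^ 2 := by
      rw [inner_add_right, Submodule.inner_left_of_mem_orthogonal hn hw, zero_add]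
      exact inner_self_eq_norm_sq (𝕜 := ℂ) w
    rw [h3] at h2
    refine h2.congr fun j => ?_
    rw [hMv, inner_smul_left, sum_inner, ← Complex.re_sum]
    have : (starRingEnd ℂ) ((G j).card : ℂ)⁻¹ = (((G j).card : ℝ)⁻¹ : ℝ) := by simp
    rw [this, Complex.re_ofReal_mul]

/-- The version of `exists_tendsto_average_inner` for spaces that need be neither complete nor
separated. -/
lemma exists_tendsto_average_inner_of_seminormed {𝒮 J E : Type*} [Semigroup 𝒮] [DecidableEq 𝒮]
    [SeminormedAddCommGroup E] [InnerProductSpace ℂ E]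
    (hrc : ∀ r s t : 𝒮, r * t = s * t → r = s)
    {l : Filter J} [l.NeBot] {G : J → Finset 𝒮} (hGne : ∀ j, (G j).Nonempty)
    (hG : ∀ s : 𝒮,
      Tendsto (fun j => ((symmDiff ((G j).image (· * s)) (G j)).card : ℝ) / (G j).card)
        l (nhds 0))
    (T : 𝒮 → E →ₗ[ℂ] E) (hT : ∀ s t v, T (s * t) v = T s (T t v)) (hT1 : ∀ s v, ‖T s v‖ ≤ ‖v‖)
    (e : E) (he : ‖e‖ ≤ 1) (hTe : ∀ s v, inner ℂ (T s v) e = inner ℂ v e) (x : E) :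
    ∃ c : ℝ, ‖(inner ℂ x e : ℂ)‖ ^ 2 ≤ c ∧
      Tendsto (fun j => ((G j).card : ℝ)⁻¹ * ∑ s ∈ G j, (inner ℂ (T s x) x : ℂ).re) l
        (nhds c) := by
  let U : 𝒮 → E →L[ℂ] E := fun s => (T s).mkContinuous 1 fun v => by simpa using hT1 s v
  have hU : ∀ s v, U s v = T s v := fun s v => rfl
  have h := exists_tendsto_average_inner (H := UniformSpace.Completion E) hrc hGne hG
    (fun s => (U s).completion) ?_ ?_ (e : UniformSpace.Completion E) (by simpa using he) ?_
    (x : UniformSpace.Completion E)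
  · simpa [hU] using h
  · intro s t v
    induction v using UniformSpace.Completion.induction_on with
    | hp => apply isClosed_eq <;> fun_prop
    | ih v => simp [hU, hT]
  · intro s v
    induction v using UniformSpace.Completion.induction_on with
    | hp => apply isClosed_le <;> fun_prop
    | ih v => simpa [hU] using hT1 s v
  · intro s v
    induction v using UniformSpace.Completion.induction_on with
    | hp => apply isClosed_eq <;> fun_prop
    | ih v => simpa [hU] using hTe s v

/-- Markov–Schwarz operators preserving a positive functional `φ` with `φ 1 ≤ 1`: the averages of
`φ ((S s x)⋆ x)` along a right Følner net converge to a number which is at least `|φ x|²`. -/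
lemma exists_tendsto_average_of_invariant {𝒮 J A : Type*} [Semigroup 𝒮] [DecidableEq 𝒮]
    [CStarAlgebra A] [PartialOrder A] [StarOrderedRing A]
    (hrc : ∀ r s t : 𝒮, r * t = s * t → r = s)
    {l : Filter J} [l.NeBot] {G : J → Finset 𝒮} (hGne : ∀ j, (G j).Nonempty)
    (hG : ∀ s : 𝒮,
      Tendsto (fun j => ((symmDiff ((G j).image (· * s)) (G j)).card : ℝ) / (G j).card)
        l (nhds 0))
    (S : 𝒮 → A →ₗ[ℂ] A) (hrep : ∀ s t a, S (s * t) a = S s (S t a))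
    (hSchwarz : ∀ t a, star (S t a) * S t a ≤ S t (star a * a))
    (φ : A →ₚ[ℂ] ℂ) (hφ1 : (φ 1).re ≤ 1) (hφ : ∀ s a, φ (S s a) = φ a) (x : A) :
    ∃ c : ℝ, ‖φ x‖ ^ 2 ≤ c ∧
      Tendsto (fun j => ((G j).card : ℝ)⁻¹ * ∑ s ∈ G j, (φ (star (S s x) * x)).re) l
        (nhds c) := by
  have hstar : ∀ a, φ (star a) = star (φ a) := fun a => map_star φ a
  have h := exists_tendsto_average_inner_of_seminormed (E := φ.PreGNS) hrc hGne hG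
    (fun s => φ.toPreGNS.toLinearMap ∘ₗ S s ∘ₗ φ.ofPreGNS.toLinearMap) ?_ ?_ (φ.toPreGNS 1) ?_ ?_
    (φ.toPreGNS x)
  · simpa [PositiveLinearMap.preGNS_inner_def, hstar] using h
  · intro s t v
    simp [hrep]
  · intro s v
    rw [PositiveLinearMap.preGNS_norm_def, PositiveLinearMap.preGNS_norm_def]
    refine Real.sqrt_le_sqrt ?_
    have := (Complex.le_def.1 (OrderHomClass.mono φ (hSchwarz s (φ.ofPreGNS v)))).1
    rw [hφ] at this
    simpa using this
  · rw [PositiveLinearMap.preGNS_norm_def]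
    simpa using hφ1
  · intro s v
    simp [PositiveLinearMap.preGNS_inner_def, hstar, hφ]

/-- A uniformly bounded family of positive functionals converges pointwise along every ultrafilter
to a positive functional. -/
lemma exists_positiveLinearMap_tendsto {I A : Type*} [CStarAlgebra A] [PartialOrder A]
    [StarOrderedRing A] (𝒰 : Ultrafilter I) (φ : I → A →ₚ[ℂ] ℂ) (hφ : ∀ i a, ‖φ i a‖ ≤ ‖a‖) :
    ∃ ψ : A →ₚ[ℂ] ℂ, ∀ a, Tendsto (fun i => φ i a) 𝒰 (nhds (ψ a)) := by
  have hex : ∀ a : A, ∃ z : ℂ, Tendsto (fun i => φ i a) 𝒰 (nhds z) := by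
    intro a
    obtain ⟨z, -, hz⟩ := (isCompact_closedBall (0 : ℂ) ‖a‖).ultrafilter_le_nhds
      (𝒰.map fun i => φ i a) (by
        rw [le_principal_iff]
        exact Ultrafilter.mem_map.2 (univ_mem' fun i => by simpa using hφ i a))
    exact ⟨z, hz⟩
  choose ψ hψ using hex
  let Ψ : A →ₗ[ℂ] ℂ :=
    { toFun := ψ
      map_add' := fun a b => tendsto_nhds_unique (hψ (a + b))
        (by simpa using (hψ a).add (hψ b))
      map_smul' := fun c a => tendsto_nhds_unique (hψ (c • a))
        (by simpa using (hψ a).const_mul c) }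
  refine ⟨PositiveLinearMap.mk₀ Ψ fun a ha => ?_, hψ⟩
  exact ge_of_tendsto' (hψ a) fun i => (φ i).map_nonneg ha

/-- The van der Corput inequality for a net of asymptotically invariant positive functionals. -/
lemma limsup_norm_sq_le_liminf_average_limsup {𝒮 I J A : Type*} [Semigroup 𝒮] [DecidableEq 𝒮]
    [CStarAlgebra A] [PartialOrder A] [StarOrderedRing A]
    (hrc : ∀ r s t : 𝒮, r * t = s * t → r = s)
    {k : Filter I} [k.NeBot] {l : Filter J} [l.NeBot]
    {G : J → Finset 𝒮} (hGne : ∀ j, (G j).Nonempty)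
    (hG : ∀ s : 𝒮,
      Tendsto (fun j => ((symmDiff ((G j).image (· * s)) (G j)).card : ℝ) / (G j).card)
        l (nhds 0))
    (S : 𝒮 → A →ₗ[ℂ] A) (hrep : ∀ s t a, S (s * t) a = S s (S t a))
    (hSchwarz : ∀ t a, star (S t a) * S t a ≤ S t (star a * a))
    (hS : ∀ t a, ‖S t a‖ ≤ ‖a‖)
    (φ : I → A →ₚ[ℂ] ℂ) (hφ : ∀ i a, ‖φ i a‖ ≤ ‖a‖)
    (hinv : ∀ s a, Tendsto (fun i => φ i (S s a) - φ i a) k (nhds 0)) (x : A) :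
    limsup (fun i => ‖φ i x‖ ^ 2) k ≤
      liminf (fun j => ((G j).card : ℝ)⁻¹ * ∑ s ∈ G j,
        limsup (fun i => (φ i (star (S s x) * x)).re) k) l := by
  have hone : ‖(1 : A)‖ ≤ 1 := by
    cases subsingleton_or_nontrivial A
    · simp [Subsingleton.elim (1 : A) 0]
    · exact CStarRing.norm_one.le
  have hre : ∀ i a, |(φ i a).re| ≤ ‖a‖ := fun i a => (Complex.abs_re_le_norm _).trans (hφ i a)
  have hbdd : ∀ a, IsBoundedUnder (· ≤ ·) k fun i => (φ i a).re := fun a =>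
    isBoundedUnder_of ⟨‖a‖, fun i => (abs_le.1 (hre i a)).2⟩
  have hcobdd : ∀ a, IsCoboundedUnder (· ≤ ·) k fun i => (φ i a).re := fun a =>
    (isBoundedUnder_of ⟨-‖a‖, fun i => (abs_le.1 (hre i a)).1⟩ :
      IsBoundedUnder (· ≥ ·) k fun i => (φ i a).re).isCoboundedUnder_le
  have hlimsup : ∀ s, limsup (fun i => (φ i (star (S s x) * x)).re) k ≤ ‖x‖ * ‖x‖ := by
    intro s
    refine limsup_le_of_le (hcobdd _) (Eventually.of_forall fun i => ?_)
    refine ((le_abs_self _).trans (hre i _)).trans ((norm_mul_le _ _).trans ?_)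
    rw [norm_star]
    gcongr
    exact hS s x
  have hRcobdd : IsCoboundedUnder (· ≥ ·) l fun j => ((G j).card : ℝ)⁻¹ * ∑ s ∈ G j,
      limsup (fun i => (φ i (star (S s x) * x)).re) k := by
    refine (isBoundedUnder_of ⟨‖x‖ * ‖x‖, fun j => ?_⟩ :
      IsBoundedUnder (· ≤ ·) l _).isCoboundedUnder_ge
    have hpos : (0 : ℝ) < (G j).card := by exact_mod_cast (hGne j).card_pos
    rw [inv_mul_le_iff₀ hpos]
    refine (sum_le_sum fun s _ => hlimsup s).trans ?_
    simp
  refine le_of_forall_lt_imp_le_of_dense fun b hb => ?_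
  have hfreq : ∃ᶠ i in k, b < ‖φ i x‖ ^ 2 :=
    frequently_lt_of_lt_limsup (isBoundedUnder_of ⟨0, fun i => by positivity⟩ :
      IsBoundedUnder (· ≥ ·) k _).isCoboundedUnder_le hb
  have : (k ⊓ 𝓟 {i | b < ‖φ i x‖ ^ 2}).NeBot := frequently_iff_neBot.1 hfreq
  let 𝒰 := Ultrafilter.of (k ⊓ 𝓟 {i | b < ‖φ i x‖ ^ 2})
  have h𝒰 : (𝒰 : Filter I) ≤ k ⊓ 𝓟 {i | b < ‖φ i x‖ ^ 2} := Ultrafilter.of_le _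
  have h𝒰k : (𝒰 : Filter I) ≤ k := h𝒰.trans inf_le_left
  obtain ⟨ψ, hψ⟩ := exists_positiveLinearMap_tendsto 𝒰 φ hφ
  have hψinv : ∀ s a, ψ (S s a) = ψ a := fun s a => sub_eq_zero.1 <|
    tendsto_nhds_unique ((hψ (S s a)).sub (hψ a)) ((hinv s a).mono_left h𝒰k)
  have hψre : ∀ a, Tendsto (fun i => (φ i a).re) 𝒰 (nhds (ψ a).re) := fun a =>
    (Complex.continuous_re.tendsto _).comp (hψ a)
  have hψ1 : (ψ 1).re ≤ 1 :=
    le_of_tendsto' (hψre 1) fun i => ((le_abs_self _).trans (hre i 1)).trans hone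
  have hbψ : b ≤ ‖ψ x‖ ^ 2 :=
    ge_of_tendsto ((hψ x).norm.pow 2) <| mem_of_superset
      (le_principal_iff.1 (h𝒰.trans inf_le_right)) fun i (hi : b < _) => hi.le
  obtain ⟨c, hc, hlim⟩ :=
    exists_tendsto_average_of_invariant hrc hGne hG S hrep hSchwarz ψ hψ1 hψinv x
  have hle : ∀ a, (ψ a).re ≤ limsup (fun i => (φ i a).re) k := by
    intro a
    rw [← (hψre a).limsup_eq]
    exact limsup_le_limsup_of_le h𝒰k
      (isBoundedUnder_of ⟨-‖a‖, fun i => (abs_le.1 (hre i a)).1⟩ :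
        IsBoundedUnder (· ≥ ·) 𝒰 fun i => (φ i a).re).isCoboundedUnder_le (hbdd a)
  refine (hbψ.trans hc).trans ?_
  rw [← hlim.liminf_eq]
  refine liminf_le_liminf (Eventually.of_forall fun j => ?_) hlim.isBoundedUnder_ge hRcobdd
  gcongr with s
  exact hle _

/-- An operator satisfying the Schwarz inequality is a contraction. -/
lemma norm_apply_le_of_schwarz {A : Type*} [CStarAlgebra A] [PartialOrder A] [StarOrderedRing A]
    (T : A →L[ℂ] A) (hT : ∀ a, star (T a) * T a ≤ T (star a * a)) (a : A) : ‖T a‖ ≤ ‖a‖ := by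
  have hsq : ∀ a, ‖T a‖ * ‖T a‖ ≤ ‖T‖ * (‖a‖ * ‖a‖) := by
    intro a
    rw [← CStarRing.norm_star_mul_self, ← CStarRing.norm_star_mul_self (x := a)]
    exact (CStarAlgebra.norm_le_norm_of_nonneg_of_le (star_mul_self_nonneg _) (hT a)).trans
      (T.le_opNorm _)
  have hnorm : ‖T‖ ≤ √‖T‖ := by
    refine T.opNorm_le_bound (Real.sqrt_nonneg _) fun a => ?_
    refine abs_le_of_sq_le_sq' ?_ (by positivity) |>.2
    rw [mul_pow, Real.sq_sqrt (norm_nonneg _)]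
    simpa [sq] using hsq a
  have hone : ‖T‖ ≤ 1 := by
    by_contra! h
    have := (Real.le_sqrt (norm_nonneg _) (norm_nonneg _)).1 hnorm
    nlinarith
  exact T.le_of_opNorm_le_of_le hone le_rfl |>.trans (one_mul _).le

/-- An operator satisfying the Schwarz inequality preserves positivity. -/
lemma apply_nonneg_of_schwarz {A : Type*} [CStarAlgebra A] [PartialOrder A] [StarOrderedRing A]
    (T : A →L[ℂ] A) (hT : ∀ a, star (T a) * T a ≤ T (star a * a)) {a : A} (ha : 0 ≤ a) :
    0 ≤ T a := by
  obtain ⟨b, rfl⟩ := CStarAlgebra.nonneg_iff_eq_star_mul_self.1 ha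
  exact (star_mul_self_nonneg _).trans (hT b)

/-- **Van der Corput inequality on C*-algebras along Følner nets.**
Let `𝒮` be a right cancellative semigroup with right Følner nets `(F i)` and `(G j)`,
let `S : 𝒮 → 𝓛(A)` be a semigroup representation by Markov–Schwarz operators on a unital
C*-algebra `A` and let `μ i` be a state on `A` for every `i`.  Then for every `x ∈ A`,
`limsup_i |⟨(1/|Fᵢ|) ∑_{t∈Fᵢ} Sₜ x, μᵢ⟩|² ≤
  liminf_j (1/|Gⱼ|) ∑_{s∈Gⱼ} limsup_i (1/|Fᵢ|) ∑_{t∈Fᵢ} Re ⟨Sₜ((Sₛ x)⋆ x), μᵢ⟩`. -/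
theorem vdc_cstar_folner {𝒮 : Type*} [Semigroup 𝒮] [DecidableEq 𝒮]
    (hrc : ∀ r s t : 𝒮, r * t = s * t → r = s)
    {I : Type*} [Preorder I] [IsDirected I (· ≤ ·)] [Nonempty I]
    {J : Type*} [Preorder J] [IsDirected J (· ≤ ·)] [Nonempty J]
    (F : I → Finset 𝒮) (hFne : ∀ i, (F i).Nonempty)
    (hF : ∀ s : 𝒮,
      Tendsto (fun i => ((symmDiff ((F i).image (· * s)) (F i)).card : ℝ) / (F i).card)
        atTop (nhds 0))
    (G : J → Finset 𝒮) (hGne : ∀ j, (G j).Nonempty)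
    (hG : ∀ s : 𝒮,
      Tendsto (fun j => ((symmDiff ((G j).image (· * s)) (G j)).card : ℝ) / (G j).card)
        atTop (nhds 0))
    {A : Type*} [NormedRing A] [StarRing A] [CStarRing A]
    [NormedAlgebra ℂ A] [CompleteSpace A] [StarModule ℂ A]
    [PartialOrder A] [StarOrderedRing A]
    (S : 𝒮 → A →L[ℂ] A)
    (hrep : ∀ s t : 𝒮, S (s * t) = S s * S t)
    (hS1 : ∀ t : 𝒮, S t 1 = 1)
    (hSchwarz : ∀ t : 𝒮, ∀ x : A, star (S t x) * S t x ≤ S t (star x * x))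
    (μ : I → A →L[ℂ] ℂ)
    (hμpos : ∀ i, ∀ a : A, 0 ≤ a → 0 ≤ μ i a)
    (hμnorm : ∀ i, ‖μ i‖ = 1)
    (x : A) :
    limsup (fun i => ‖μ i (((F i).card : ℂ)⁻¹ • ∑ t ∈ F i, S t x)‖ ^ 2) atTop ≤
      liminf (fun j => ((G j).card : ℝ)⁻¹ * ∑ s ∈ G j,
        limsup (fun i =>
          ((F i).card : ℝ)⁻¹ * ∑ t ∈ F i, (μ i (S t (star (S s x) * x))).re) atTop)
        atTop := by
  let _ : CStarAlgebra A := {}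
  have hS : ∀ t a, ‖S t a‖ ≤ ‖a‖ := fun t => norm_apply_le_of_schwarz (S t) (hSchwarz t)
  have hμ : ∀ i t a, ‖μ i (S t a)‖ ≤ ‖a‖ := fun i t a => by
    simpa [hμnorm i] using ((μ i).le_opNorm (S t a)).trans
      (mul_le_mul_of_nonneg_left (hS t a) (norm_nonneg _))
  let φ : I → A →ₚ[ℂ] ℂ := fun i =>
    PositiveLinearMap.mk₀ (((F i).card : ℂ)⁻¹ • ∑ t ∈ F i, (μ i ∘L S t : A →L[ℂ] ℂ).toLinearMap)
      fun a ha => by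
        simp only [LinearMap.smul_apply, LinearMap.sum_apply, smul_eq_mul]
        refine mul_nonneg (by simp) (sum_nonneg fun t _ => ?_)
        exact hμpos i _ (apply_nonneg_of_schwarz (S t) (hSchwarz t) ha)
  have hφ_apply : ∀ i a, φ i a = ((F i).card : ℂ)⁻¹ • ∑ t ∈ F i, μ i (S t a) := fun i a => by
    change (((F i).card : ℂ)⁻¹ • ∑ t ∈ F i, (μ i ∘L S t : A →L[ℂ] ℂ).toLinearMap) a = _
    simp
  have hφ_bound : ∀ i a, ‖φ i a‖ ≤ ‖a‖ := by
    intro i a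
    have hpos : (0 : ℝ) < (F i).card := by exact_mod_cast (hFne i).card_pos
    rw [hφ_apply, norm_smul, norm_inv, Complex.norm_natCast, inv_mul_le_iff₀ hpos]
    refine (norm_sum_le_of_le _ fun t _ => hμ i t a).trans ?_
    simp
  have hφ_inv : ∀ s a, Tendsto (fun i => φ i (S s a) - φ i a) atTop (nhds 0) := by
    intro s a
    refine (tendsto_average_translate_sub (fun r t h => hrc r t s h) (hF s)
      (fun i t => μ i (S t a)) fun i t => hμ i t a).congr fun i => ?_
    simp [hφ_apply, hrep, mul_sub]
  have hφ_re : ∀ i a, (φ i a).re = ((F i).card : ℝ)⁻¹ * ∑ t ∈ F i, (μ i (S t a)).re := by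
    intro i a
    rw [hφ_apply, ← Complex.re_sum, smul_eq_mul, ← Complex.re_ofReal_mul]
    simp
  have h := limsup_norm_sq_le_liminf_average_limsup (k := atTop) hrc hGne hG
    (fun s => (S s).toLinearMap) (fun s t a => by simp [hrep]) hSchwarz hS φ hφ_bound hφ_inv x
  simp only [hφ_re, ContinuousLinearMap.coe_coe] at h
  simpa only [hφ_apply, map_smul, map_sum] using h
end

section
/- Let 𝒮 be a right cancellative semigroup, let (F_i)_{i∈I} and (G_j)_{j∈J} be right Følner nets for 𝒮, let E be a pre-Hilbert module over a commutative unital C*-algebra A, let S : 𝒮 → 𝓛(A) be a semigroup representation by Markov operators, let T : 𝒮 → 𝓛(E) be a semigroup representation such that T_t is S_t-dominated for every t ∈ 𝒮, and let μ_i be a state on A for every i ∈ I. Then for every x ∈ E: limsup_i ⟨|(1/|F_i|) Σ_{t∈F_i} T_t x|_A², μ_i⟩ ≤ liminf_j (1/|G_j|) Σ_{s∈G_j} limsup_i (1/|F_i|) Σ_{t∈F_i} Re⟨S_t (x | T_s x)_A, μ_i⟩. -/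
open Filter Finset
open scoped ComplexOrder

section Averages

variable {𝒮 : Type*} {E : Type*} [AddCommGroup E] [Module ℂ E]

lemma seminorm_sum_le (p : Seminorm ℂ E) (F : Finset 𝒮) (u : 𝒮 → E) :
    p (∑ t ∈ F, u t) ≤ ∑ t ∈ F, p (u t) :=
  le_sum_of_subadditive p (map_zero p).le (map_add_le_add p) F u

lemma average_sub_mem_span (T : 𝒮 → E →ₗ[ℂ] E) (x : E) {F : Finset 𝒮} (hF : F.Nonempty) :
    ((F.card : ℂ)⁻¹ • ∑ t ∈ F, T t x) - x ∈
      Submodule.span ℂ (Set.range fun z : E × 𝒮 => z.1 - T z.2 z.1) := by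
  have hc : (F.card : ℂ) ≠ 0 := by simpa using hF.ne_empty
  have : ((F.card : ℂ)⁻¹ • ∑ t ∈ F, T t x) - x = -((F.card : ℂ)⁻¹ • ∑ t ∈ F, (x - T t x)) := by
    rw [sum_sub_distrib, sum_const, ← Nat.cast_smul_eq_nsmul ℂ, smul_sub, smul_smul,
      inv_mul_cancel₀ hc, one_smul, neg_sub]
  rw [this]
  exact neg_mem (Submodule.smul_mem _ _ (sum_mem fun t _ =>
    Submodule.subset_span ⟨(x, t), rfl⟩))

lemma seminorm_average_sq_le (p : Seminorm ℂ E) (u : 𝒮 → E) (F : Finset 𝒮) :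
    p ((F.card : ℂ)⁻¹ • ∑ t ∈ F, u t) ^ 2 ≤ (F.card : ℝ)⁻¹ * ∑ t ∈ F, p (u t) ^ 2 := by
  rw [map_smul_eq_mul, norm_inv, Complex.norm_natCast, mul_pow]
  have h1 : p (∑ t ∈ F, u t) ^ 2 ≤ F.card * ∑ t ∈ F, p (u t) ^ 2 :=
    (pow_le_pow_left₀ (apply_nonneg _ _) (seminorm_sum_le p F u) 2).trans
      sq_sum_le_card_mul_sum_sq
  rcases F.eq_empty_or_nonempty with rfl | hF
  · simp
  have hc : (F.card : ℝ) ≠ 0 := by simpa using hF.ne_empty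
  calc ((F.card : ℝ)⁻¹) ^ 2 * p (∑ t ∈ F, u t) ^ 2
      ≤ ((F.card : ℝ)⁻¹) ^ 2 * (F.card * ∑ t ∈ F, p (u t) ^ 2) := by gcongr
    _ = _ := by field_simp

variable [Semigroup 𝒮] [DecidableEq 𝒮]

/-- Translating the index in a finite sum changes it by at most a multiple of the cardinality of
the symmetric difference. -/
lemma seminorm_sum_mul_right_sub_le (hrc : ∀ r s t : 𝒮, r * t = s * t → r = s)
    (p : Seminorm ℂ E) (u : 𝒮 → E) {K : ℝ} (hK : ∀ t, p (u t) ≤ K) (F : Finset 𝒮) (s : 𝒮) :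
    p (∑ t ∈ F, u t - ∑ t ∈ F, u (t * s)) ≤ (symmDiff (F.image (· * s)) F).card * K := by
  have himg : ∑ t ∈ F, u (t * s) = ∑ t ∈ F.image (· * s), u t :=
    (sum_image (fun a _ b _ h => hrc a b s h)).symm
  have hsplit : ∑ t ∈ F, u t - ∑ t ∈ F.image (· * s), u t
      = ∑ t ∈ F \ F.image (· * s), u t - ∑ t ∈ F.image (· * s) \ F, u t := by
    rw [← sum_inter_add_sum_sdiff F (F.image (· * s)) u,
      ← sum_inter_add_sum_sdiff (F.image (· * s)) F u, inter_comm (F.image (· * s)) F]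
    abel
  have hsum : ∀ H : Finset 𝒮, p (∑ t ∈ H, u t) ≤ H.card * K := fun H =>
    (seminorm_sum_le p H u).trans
      ((sum_le_card_nsmul H _ K fun t _ => hK t).trans_eq (nsmul_eq_mul _ _))
  rw [himg, hsplit]
  refine (map_sub_le_add p _ _).trans ((add_le_add (hsum _) (hsum _)).trans_eq ?_)
  rw [symmDiff_def, sup_eq_union, card_union_of_disjoint disjoint_sdiff_sdiff]
  push_cast
  ring

lemma tendsto_seminorm_average_sub_mul_right {ι : Type*} {l : Filter ι}
    (hrc : ∀ r s t : 𝒮, r * t = s * t → r = s) (F : ι → Finset 𝒮) (s : 𝒮)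
    (hF : Tendsto (fun i => ((symmDiff ((F i).image (· * s)) (F i)).card : ℝ) / (F i).card)
        l (nhds 0))
    (p : ι → Seminorm ℂ E) (u : ι → 𝒮 → E) {K : ℝ} (hK : ∀ i t, p i (u i t) ≤ K) :
    Tendsto (fun i => p i (((F i).card : ℂ)⁻¹ • (∑ t ∈ F i, u i t - ∑ t ∈ F i, u i (t * s))))
      l (nhds 0) := by
  refine squeeze_zero (fun i => apply_nonneg _ _) (fun i => ?_)
    ((hF.mul_const K).trans_eq (by rw [zero_mul]))
  rw [map_smul_eq_mul, norm_inv, Complex.norm_natCast, div_eq_inv_mul, mul_assoc]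
  gcongr
  exact seminorm_sum_mul_right_sub_le hrc (p i) (u i) (hK i) (F i) s

/-- Følner averages of a bounded representation vanish asymptotically on the span of the
coboundaries `z - T r z`. -/
lemma tendsto_seminorm_average_of_mem_span {ι : Type*} {l : Filter ι}
    (hrc : ∀ r s t : 𝒮, r * t = s * t → r = s) (F : ι → Finset 𝒮)
    (hF : ∀ s : 𝒮,
      Tendsto (fun i => ((symmDiff ((F i).image (· * s)) (F i)).card : ℝ) / (F i).card)
        l (nhds 0))
    (T : 𝒮 → E →ₗ[ℂ] E) (hT : ∀ s t : 𝒮, T (s * t) = T s * T t)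
    (p : ι → Seminorm ℂ E) (hp : ∀ y, ∃ K : ℝ, ∀ i t, p i (T t y) ≤ K)
    {n : E} (hn : n ∈ Submodule.span ℂ (Set.range fun z : E × 𝒮 => z.1 - T z.2 z.1)) :
    Tendsto (fun i => p i (((F i).card : ℂ)⁻¹ • ∑ t ∈ F i, T t n)) l (nhds 0) := by
  induction hn using Submodule.span_induction with
  | mem n hn =>
    obtain ⟨⟨z, r⟩, rfl⟩ := hn
    obtain ⟨K, hK⟩ := hp z
    have := tendsto_seminorm_average_sub_mul_right hrc F r (hF r) p (fun _ t => T t z) hK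
    simpa [hT, sum_sub_distrib] using this
  | zero => simpa using tendsto_const_nhds
  | add a b _ _ ha hb =>
    refine squeeze_zero (fun i => apply_nonneg _ _) (fun i => ?_)
      ((ha.add hb).trans_eq (by rw [zero_add]))
    simp only [map_add, sum_add_distrib, smul_add]
    exact map_add_le_add _ _ _
  | smul c a _ ha =>
    have hca := ha.const_mul ‖c‖
    rw [mul_zero] at hca
    refine hca.congr fun i => ?_
    simp only [LinearMap.map_smul, ← smul_sum]
    rw [smul_comm, map_smul_eq_mul (p i) c]

/-- Mean ergodic inequality for a contractive representation on a semi-inner product space whose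
seminorm is `p` and whose real inner product is `B`. -/
lemma eventually_sub_le_inner_average {ι : Type*} {l : Filter ι}
    (hrc : ∀ r s t : 𝒮, r * t = s * t → r = s) (G : ι → Finset 𝒮) (hGne : ∀ j, (G j).Nonempty)
    (hG : ∀ s : 𝒮,
      Tendsto (fun j => ((symmDiff ((G j).image (· * s)) (G j)).card : ℝ) / (G j).card)
        l (nhds 0))
    (T : 𝒮 → E →ₗ[ℂ] E) (hT : ∀ s t : 𝒮, T (s * t) = T s * T t)
    (p : Seminorm ℂ E) (hp : ∀ t y, p (T t y) ≤ p y) (B : E → E → ℝ)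
    (hB : ∀ (a b : ℝ) (y z : E), p ((a : ℂ) • y + (b : ℂ) • z) ^ 2
      = a ^ 2 * p y ^ 2 + 2 * a * b * B y z + b ^ 2 * p z ^ 2)
    (x : E) {L : ℝ}
    (hL : ∀ n ∈ Submodule.span ℂ (Set.range fun z : E × 𝒮 => z.1 - T z.2 z.1),
      L ≤ p (x + n) ^ 2) {ε : ℝ} (hε : 0 < ε) :
    ∀ᶠ j in l, L - ε ≤ B x (((G j).card : ℂ)⁻¹ • ∑ t ∈ G j, T t x) := by
  set N := Submodule.span ℂ (Set.range fun z : E × 𝒮 => z.1 - T z.2 z.1)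
  set D : Set ℝ := (fun n => p (x + n) ^ 2) '' (N : Set E)
  have hDne : D.Nonempty := ⟨_, 0, N.zero_mem, rfl⟩
  have hDbdd : BddBelow D := ⟨0, by rintro _ ⟨n, _, rfl⟩; positivity⟩
  set m := sInf D
  have hLm : L ≤ m := le_csInf hDne (by rintro _ ⟨n, hn, rfl⟩; exact hL n hn)
  have hm0 : 0 ≤ m := le_csInf hDne (by rintro _ ⟨n, hn, rfl⟩; positivity)
  have hm : ∀ n ∈ N, m ≤ p (x + n) ^ 2 := fun n hn => csInf_le hDbdd ⟨n, hn, rfl⟩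
  obtain ⟨δ, hδ0, hδ2, hδε⟩ : ∃ δ : ℝ, 0 < δ ∧ δ ≤ 1 / 2 ∧ δ * (1 + p x ^ 2) ≤ ε := by
    have hpx : 0 < 1 + p x ^ 2 := by positivity
    refine ⟨min (1 / 2) (ε / (1 + p x ^ 2)), by positivity, min_le_left _ _, ?_⟩
    exact (mul_le_mul_of_nonneg_right (min_le_right _ _) hpx.le).trans_eq
      (div_mul_cancel₀ _ hpx.ne')
  obtain ⟨_, ⟨n, hn, rfl⟩, hnlt⟩ := exists_lt_of_csInf_lt hDne
    (show m < m + δ ^ 2 by have := pow_pos hδ0 2; linarith)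
  have h0 := tendsto_seminorm_average_of_mem_span hrc G hG T hT (fun _ => p)
    (fun y => ⟨p y, fun _ t => hp t y⟩) hn
  have h1 : Tendsto (fun j => (p (x + n) + p (((G j).card : ℂ)⁻¹ • ∑ t ∈ G j, T t n)) ^ 2) l
      (nhds (p (x + n) ^ 2)) := by
    simpa using (h0.const_add (p (x + n))).pow 2
  filter_upwards [h1.eventually_lt_const hnlt] with j hj
  set y := ((G j).card : ℂ)⁻¹ • ∑ t ∈ G j, T t x with hy
  have hc : ((G j).card : ℝ) ≠ 0 := by simpa using (hGne j).ne_empty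
  have hyle : p y ≤ p (x + n) + p (((G j).card : ℂ)⁻¹ • ∑ t ∈ G j, T t n) := by
    have hyeq : y = ((G j).card : ℂ)⁻¹ • ∑ t ∈ G j, T t (x + n)
        - ((G j).card : ℂ)⁻¹ • ∑ t ∈ G j, T t n := by
      simp only [map_add, sum_add_distrib, smul_add, add_sub_cancel_right, hy]
    rw [hyeq]
    refine (map_sub_le_add p _ _).trans (add_le_add_left ?_ _)
    rw [map_smul_eq_mul, norm_inv, Complex.norm_natCast]
    calc ((G j).card : ℝ)⁻¹ * p (∑ t ∈ G j, T t (x + n))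
        ≤ ((G j).card : ℝ)⁻¹ * ((G j).card * p (x + n)) := by
          gcongr
          exact (seminorm_sum_le p _ _).trans
            ((sum_le_card_nsmul _ _ _ fun t _ => hp t _).trans_eq (nsmul_eq_mul _ _))
      _ = p (x + n) := by field_simp
  have hysq : p y ^ 2 ≤ m + δ ^ 2 :=
    (pow_le_pow_left₀ (apply_nonneg _ _) hyle 2).trans hj.le
  have hcomb : m ≤ p ((δ : ℂ) • x + ((1 - δ : ℝ) : ℂ) • y) ^ 2 := by
    have hmem := hm _ (N.smul_mem ((1 - δ : ℝ) : ℂ) (average_sub_mem_span T x (hGne j)))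
    convert hmem using 3
    rw [← hy]
    push_cast
    module
  rw [hB] at hcomb
  have hkey : 2 * δ * (1 - δ) * (m - δ * (1 + p x ^ 2)) ≤ 2 * δ * (1 - δ) * B x y := by
    have h1 : (1 - δ) ^ 2 * p y ^ 2 ≤ (1 - δ) ^ 2 * (m + δ ^ 2) := by gcongr
    have h2 : 0 ≤ δ ^ 2 * m := by positivity
    have h3 : 0 ≤ δ ^ 2 * (1 - 2 * δ) * (1 + p x ^ 2) := by
      have : 0 ≤ 1 - 2 * δ := by linarith
      positivity
    have h4 : 0 ≤ δ ^ 2 * (1 - (1 - δ) ^ 2) := by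
      have : 0 ≤ 1 - (1 - δ) ^ 2 := by nlinarith
      positivity
    nlinarith
  have := le_of_mul_le_mul_left hkey (by have : 0 < 1 - δ := by linarith
                                         positivity)
  linarith

end Averages

section PositiveFunctionals

variable {A : Type*} [CStarAlgebra A] [PartialOrder A]
  {E : Type*} [AddCommGroup E] [Module ℂ E]

/-- A pointwise bounded family of positive functionals has a pointwise limit along every
ultrafilter, which is again a positive functional. -/
lemma exists_tendsto_ultrafilter {ι : Type*} (𝒰 : Ultrafilter ι) (φ : ι → A →ₗ[ℂ] ℂ)
    (hφ : ∀ i a, 0 ≤ a → 0 ≤ φ i a) (hbdd : ∀ a, ∃ K : ℝ, ∀ i, ‖φ i a‖ ≤ K) :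
    ∃ ν : A →ₗ[ℂ] ℂ, (∀ a, 0 ≤ a → 0 ≤ ν a) ∧
      ∀ a, Tendsto (fun i => φ i a) 𝒰 (nhds (ν a)) := by
  have hlim : ∀ a, ∃ z, Tendsto (fun i => φ i a) 𝒰 (nhds z) := fun a => by
    obtain ⟨K, hK⟩ := hbdd a
    obtain ⟨z, -, hz⟩ := (isCompact_closedBall (0 : ℂ) K).ultrafilter_le_nhds
      (𝒰.map fun i => φ i a) (le_principal_iff.2 (Filter.mem_map.2 (Filter.univ_mem' fun i => by
        simpa using hK i)))
    exact ⟨z, hz⟩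
  choose ν hν using hlim
  refine ⟨{ toFun := ν, map_add' := fun a b => ?_, map_smul' := fun c a => ?_ }, ?_, hν⟩
  · exact tendsto_nhds_unique (hν _) (((hν a).add (hν b)).congr fun i => (map_add _ _ _).symm)
  · exact tendsto_nhds_unique (hν _) (((hν a).const_smul c).congr fun i => (map_smul _ _ _).symm)
  · exact fun a ha => ge_of_tendsto' (hν a) fun i => hφ i a ha

variable [StarOrderedRing A]

lemma map_star_of_map_nonneg (φ : A →ₗ[ℂ] ℂ) (hφ : ∀ a, 0 ≤ a → 0 ≤ φ a) (a : A) :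
    φ (star a) = star (φ a) := by
  have ha : a ∈ Submodule.span ℂ {b : A | 0 ≤ b} := by
    rw [CStarAlgebra.span_nonneg]; trivial
  induction ha using Submodule.span_induction with
  | mem b hb =>
    rw [(IsSelfAdjoint.of_nonneg hb).star_eq, (IsSelfAdjoint.of_nonneg (hφ b hb)).star_eq]
  | zero => simp
  | add b c _ _ hb hc => simp [hb, hc]
  | smul k b _ hb => simp [hb]

/-- A positive functional composed with an `A`-valued semi-inner product gives a seminorm. -/
lemma exists_seminorm_sq_eq (ip : E → E → A) (ip_nonneg : ∀ y : E, 0 ≤ ip y y)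
    (ip_star : ∀ y z : E, star (ip y z) = ip z y)
    (ip_add : ∀ y z w : E, ip (y + z) w = ip y w + ip z w)
    (ip_smul : ∀ (c : ℂ) (y z : E), ip (c • y) z = c • ip y z)
    (φ : A →ₗ[ℂ] ℂ) (hφ : ∀ a, 0 ≤ a → 0 ≤ φ a) :
    ∃ p : Seminorm ℂ E, ∀ y, p y ^ 2 = (φ (ip y y)).re := by
  let c : PreInnerProductSpace.Core ℂ E :=
    { inner := fun y z => φ (ip z y)
      conj_inner_symm := fun y z => by
        rw [starRingEnd_apply, ← map_star_of_map_nonneg φ hφ, ip_star]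
      re_inner_nonneg := fun y => (Complex.nonneg_iff.1 (hφ _ (ip_nonneg y))).1
      add_left := fun y z w => by
        rw [← ip_star, ip_add, star_add, ip_star, ip_star, map_add]
      smul_left := fun y z k => by
        rw [← ip_star, ip_smul, star_smul, ip_star, map_smul, smul_eq_mul, starRingEnd_apply] }
  refine ⟨@normSeminorm ℂ E _ InnerProductSpace.Core.toSeminormedAddCommGroup
    InnerProductSpace.Core.toNormedSpace, fun y => ?_⟩
  exact Real.sq_sqrt (Complex.nonneg_iff.1 (hφ _ (ip_nonneg y))).1

/-- Real quadratic expansion of a positive functional along an `A`-valued inner product. -/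
lemma re_map_ip_combination (ip : E → E → A)
    (ip_star : ∀ y z : E, star (ip y z) = ip z y)
    (ip_add : ∀ y z w : E, ip (y + z) w = ip y w + ip z w)
    (ip_smul : ∀ (c : ℂ) (y z : E), ip (c • y) z = c • ip y z)
    (φ : A →ₗ[ℂ] ℂ) (hφ : ∀ a, 0 ≤ a → 0 ≤ φ a) (a b : ℝ) (y z : E) :
    (φ (ip ((a : ℂ) • y + (b : ℂ) • z) ((a : ℂ) • y + (b : ℂ) • z))).re
      = a ^ 2 * (φ (ip y y)).re + 2 * a * b * (φ (ip y z)).re + b ^ 2 * (φ (ip z z)).re := by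
  have hadd : ∀ u v w, ip w (u + v) = ip w u + ip w v := fun u v w => by
    rw [← ip_star, ip_add, star_add, ip_star, ip_star]
  have hsmul : ∀ (r : ℝ) (u v : E), ip u ((r : ℂ) • v) = (r : ℂ) • ip u v := fun r u v => by
    rw [← ip_star, ip_smul, star_smul, ip_star]; simp
  have hsymm : (φ (ip z y)).re = (φ (ip y z)).re := by
    rw [← ip_star, map_star_of_map_nonneg φ hφ]; rfl
  simp only [ip_add, ip_smul, hadd, hsmul, map_add, map_smul, smul_eq_mul, Complex.add_re,
    Complex.re_ofReal_mul, hsymm]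
  ring

/-- A family of positive functionals that is bounded at `1` is pointwise bounded. -/
lemma exists_norm_map_le {ι : Type*} (φ : ι → A →ₗ[ℂ] ℂ) (hφ : ∀ i a, 0 ≤ a → 0 ≤ φ i a)
    {M : ℝ} (hM : ∀ i, ‖φ i 1‖ ≤ M) (a : A) : ∃ K : ℝ, ∀ i, ‖φ i a‖ ≤ K := by
  have ha : a ∈ Submodule.span ℂ {b : A | 0 ≤ b} := by
    rw [CStarAlgebra.span_nonneg]; trivial
  induction ha using Submodule.span_induction with
  | mem b hb =>
    refine ⟨‖b‖ * M, fun i => ?_⟩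
    have h1 : φ i b ≤ φ i (algebraMap ℝ A ‖b‖) := by
      rw [← sub_nonneg, ← map_sub]
      exact hφ i _ (sub_nonneg.2 (IsSelfAdjoint.of_nonneg hb).le_algebraMap_norm_self)
    have h2 : φ i (algebraMap ℝ A ‖b‖) = (‖b‖ : ℂ) * φ i 1 := by
      rw [← smul_eq_mul, ← map_smul, Algebra.algebraMap_eq_smul_one, Complex.coe_smul]
    calc ‖φ i b‖ ≤ ‖φ i (algebraMap ℝ A ‖b‖)‖ :=
          CStarAlgebra.norm_le_norm_of_nonneg_of_le (hφ i b hb) h1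
      _ ≤ ‖b‖ * M := by
          rw [h2, norm_mul, Complex.norm_real, norm_norm]
          gcongr
          exact hM i
  | zero => exact ⟨0, fun i => by simp⟩
  | add b c _ _ hb hc =>
    obtain ⟨K, hK⟩ := hb
    obtain ⟨K', hK'⟩ := hc
    exact ⟨K + K', fun i => by
      rw [map_add]; exact (norm_add_le _ _).trans (add_le_add (hK i) (hK' i))⟩
  | smul k b _ hb =>
    obtain ⟨K, hK⟩ := hb
    exact ⟨‖k‖ * K, fun i => by rw [map_smul, norm_smul]; gcongr; exact hK i⟩

end PositiveFunctionals

/-- The van der Corput inequality for a complex space with a `C*`-valued inner product. -/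
theorem vdc_cstar_valued_ip {𝒮 : Type*} [Semigroup 𝒮] [DecidableEq 𝒮]
    (hrc : ∀ r s t : 𝒮, r * t = s * t → r = s)
    {I : Type*} [Preorder I] [IsDirected I (· ≤ ·)] [Nonempty I]
    {J : Type*} [Preorder J] [IsDirected J (· ≤ ·)] [Nonempty J]
    (F : I → Finset 𝒮) (hFne : ∀ i, (F i).Nonempty)
    (hF : ∀ s : 𝒮,
      Tendsto (fun i => ((symmDiff ((F i).image (· * s)) (F i)).card : ℝ) / (F i).card)
        atTop (nhds 0))
    (G : J → Finset 𝒮) (hGne : ∀ j, (G j).Nonempty)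
    (hG : ∀ s : 𝒮,
      Tendsto (fun j => ((symmDiff ((G j).image (· * s)) (G j)).card : ℝ) / (G j).card)
        atTop (nhds 0))
    {A : Type*} [CStarAlgebra A] [PartialOrder A] [StarOrderedRing A]
    {E : Type*} [AddCommGroup E] [Module ℂ E]
    (ip : E → E → A)
    (ip_nonneg : ∀ y : E, 0 ≤ ip y y)
    (ip_star : ∀ y z : E, star (ip y z) = ip z y)
    (ip_add : ∀ y z w : E, ip (y + z) w = ip y w + ip z w)
    (ip_smul : ∀ (c : ℂ) (y z : E), ip (c • y) z = c • ip y z)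
    (S : 𝒮 → A →L[ℂ] A)
    (hSrep : ∀ s t : 𝒮, S (s * t) = S s * S t)
    (hS1 : ∀ t : 𝒮, S t 1 = 1)
    (hSpos : ∀ t : 𝒮, ∀ a : A, 0 ≤ a → 0 ≤ S t a)
    (T : 𝒮 → E →ₗ[ℂ] E)
    (hTrep : ∀ s t : 𝒮, T (s * t) = T s * T t)
    (hTdom : ∀ t : 𝒮, ∀ y : E, ip (T t y) (T t y) ≤ S t (ip y y))
    (μ : I → A →L[ℂ] ℂ)
    (hμpos : ∀ i, ∀ a : A, 0 ≤ a → 0 ≤ μ i a)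
    (hμnorm : ∀ i, ‖μ i‖ = 1)
    (x : E) :
    limsup (fun i =>
        (μ i (ip (((F i).card : ℂ)⁻¹ • ∑ t ∈ F i, T t x)
                 (((F i).card : ℂ)⁻¹ • ∑ t ∈ F i, T t x))).re) atTop ≤
      liminf (fun j => ((G j).card : ℝ)⁻¹ * ∑ s ∈ G j,
        limsup (fun i =>
          ((F i).card : ℝ)⁻¹ * ∑ t ∈ F i, (μ i (S t (ip x (T s x)))).re) atTop)
        atTop := by
  have hmono : ∀ (φ : A →ₗ[ℂ] ℂ), (∀ a, 0 ≤ a → 0 ≤ φ a) → ∀ a b, a ≤ b →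
      (φ a).re ≤ (φ b).re := fun φ hφ a b hab => by
    have := (Complex.nonneg_iff.1 (hφ _ (sub_nonneg.2 hab))).1
    rwa [map_sub, Complex.sub_re, sub_nonneg] at this
  have hbdd : ∀ a : A, ∃ K : ℝ, ∀ i t, ‖μ i (S t a)‖ ≤ K := fun a => by
    obtain ⟨K, hK⟩ := exists_norm_map_le
      (fun q : I × 𝒮 => ((μ q.1).comp (S q.2)).toLinearMap)
      (fun q a ha => hμpos q.1 _ (hSpos q.2 a ha)) (M := ‖(1 : A)‖)
      (fun q => by simpa [hS1, hμnorm] using (μ q.1).le_opNorm 1) a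
    exact ⟨K, fun i t => hK (i, t)⟩
  let φ : I → A →ₗ[ℂ] ℂ := fun i =>
    ((F i).card : ℂ)⁻¹ • ∑ t ∈ F i, ((μ i).comp (S t)).toLinearMap
  have hφ_apply : ∀ i a, φ i a = ((F i).card : ℂ)⁻¹ * ∑ t ∈ F i, μ i (S t a) := fun i a => by
    simp [φ]
  have hφ_re : ∀ i a, (φ i a).re = ((F i).card : ℝ)⁻¹ * ∑ t ∈ F i, (μ i (S t a)).re :=
    fun i a => by
      rw [hφ_apply, ← Complex.ofReal_natCast, ← Complex.ofReal_inv, Complex.re_ofReal_mul,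
        Complex.re_sum]
  have hφ_pos : ∀ i a, 0 ≤ a → 0 ≤ φ i a := fun i a ha => by
    rw [hφ_apply]
    exact mul_nonneg (inv_nonneg.2 (Nat.cast_nonneg _))
      (sum_nonneg fun t _ => hμpos i _ (hSpos t a ha))
  have havg_le : ∀ (i : I) (f : 𝒮 → ℝ) (K : ℝ), (∀ t, f t ≤ K) →
      ((F i).card : ℝ)⁻¹ * ∑ t ∈ F i, f t ≤ K := fun i f K hK => by
    have hc : (0 : ℝ) < (F i).card := by exact_mod_cast (hFne i).card_pos
    rw [inv_mul_le_iff₀ hc, ← nsmul_eq_mul]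
    exact sum_le_card_nsmul _ _ _ fun t _ => hK t
  have hφ_bdd : ∀ a, ∃ K : ℝ, ∀ i, ‖φ i a‖ ≤ K := fun a => by
    obtain ⟨K, hK⟩ := hbdd a
    refine ⟨K, fun i => ?_⟩
    rw [hφ_apply, norm_mul, norm_inv, Complex.norm_natCast]
    exact (mul_le_mul_of_nonneg_left (norm_sum_le _ _) (by positivity)).trans
      (havg_le i _ K (hK i))
  choose p hp using fun i => exists_seminorm_sq_eq ip ip_nonneg ip_star ip_add ip_smul
    (μ i).toLinearMap (hμpos i)
  have hpT_sq : ∀ i t y, p i (T t y) ^ 2 ≤ (μ i (S t (ip y y))).re := fun i t y => by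
    rw [hp]
    exact hmono _ (hμpos i) _ _ (hTdom t y)
  have hpT : ∀ y, ∃ K : ℝ, ∀ i t, p i (T t y) ≤ K := fun y => by
    obtain ⟨K, hK⟩ := hbdd (ip y y)
    exact ⟨√K, fun i t => Real.le_sqrt_of_sq_le
      ((hpT_sq i t y).trans ((Complex.re_le_norm _).trans (hK i t)))⟩
  have hpavg : ∀ i y, p i (((F i).card : ℂ)⁻¹ • ∑ t ∈ F i, T t y) ≤ √(φ i (ip y y)).re :=
    fun i y => Real.le_sqrt_of_sq_le <| (seminorm_average_sq_le _ _ _).trans <| by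
      rw [hφ_re]
      gcongr with t
      exact hpT_sq i t y
  have hr_bdd_above : ∀ a, IsBoundedUnder (· ≤ ·) atTop fun i => (φ i a).re := fun a => by
    obtain ⟨K, hK⟩ := hφ_bdd a
    exact isBoundedUnder_of ⟨K, fun i => (Complex.re_le_norm _).trans (hK i)⟩
  have hr_bdd_below : ∀ a, IsBoundedUnder (· ≥ ·) atTop fun i => (φ i a).re := fun a => by
    obtain ⟨K, hK⟩ := hφ_bdd a
    exact isBoundedUnder_of ⟨-K, fun i => (abs_le.1 ((Complex.abs_re_le_norm _).trans (hK i))).1⟩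
  simp only [← hφ_re]
  have hlimsup_le : ∃ K : ℝ, ∀ s, limsup (fun i => (φ i (ip x (T s x))).re) atTop ≤ K := by
    obtain ⟨K, hK⟩ := hbdd (ip x x)
    refine ⟨K, fun s => limsup_le_of_le (hr_bdd_below _).isCoboundedUnder_le
      (Eventually.of_forall fun i => ?_)⟩
    rw [hφ_re]
    refine havg_le i _ K fun t => ?_
    have hpos : ∀ a, 0 ≤ a → 0 ≤ ((μ i).comp (S t)).toLinearMap a :=
      fun a ha => hμpos i _ (hSpos t a ha)
    have h1 := re_map_ip_combination ip ip_star ip_add ip_smul _ hpos 1 (-1) x (T s x)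
    have h2 := (Complex.nonneg_iff.1 (hpos _ (ip_nonneg
      (((1 : ℝ) : ℂ) • x + ((-1 : ℝ) : ℂ) • T s x)))).1
    have h3 := hmono _ hpos _ _ (hTdom s x)
    simp only [ContinuousLinearMap.coe_coe, ContinuousLinearMap.comp_apply] at h1 h2 h3
    have h4 : μ i (S t (S s (ip x x))) = μ i (S (t * s) (ip x x)) := by rw [hSrep]; rfl
    rw [h4] at h3
    have h5 := (Complex.re_le_norm _).trans (hK i t)
    have h6 := (Complex.re_le_norm _).trans (hK i (t * s))
    linarith
  have hip_avg : ∀ H : Finset 𝒮, ip x ((H.card : ℂ)⁻¹ • ∑ s ∈ H, T s x)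
      = (H.card : ℂ)⁻¹ • ∑ s ∈ H, ip x (T s x) := fun H => by
    have hsum : ip (∑ s ∈ H, T s x) x = ∑ s ∈ H, ip (T s x) x :=
      map_sum (AddMonoidHom.mk' (fun y => ip y x) fun y z => ip_add y z x) _ _
    rw [← ip_star, ip_smul, star_smul, hsum, star_sum]
    simp [ip_star]
  refine le_of_forall_lt_imp_le_of_dense fun c hc => ?_
  have hfreq : ∃ᶠ i in atTop, c < p i (((F i).card : ℂ)⁻¹ • ∑ t ∈ F i, T t x) ^ 2 := by
    simp only [hp]
    exact frequently_lt_of_lt_limsup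
      (IsBoundedUnder.isCoboundedUnder_le (isBoundedUnder_of ⟨0, fun i =>
        (Complex.nonneg_iff.1 (hμpos i _ (ip_nonneg _))).1⟩)) hc
  have : (atTop ⊓ Filter.principal
      {i | c < p i (((F i).card : ℂ)⁻¹ • ∑ t ∈ F i, T t x) ^ 2}).NeBot :=
    frequently_mem_iff_neBot.1 hfreq
  obtain ⟨𝒰, h𝒰⟩ := Ultrafilter.exists_le
    (atTop ⊓ Filter.principal {i | c < p i (((F i).card : ℂ)⁻¹ • ∑ t ∈ F i, T t x) ^ 2})
  have h𝒰top : (𝒰 : Filter I) ≤ atTop := h𝒰.trans inf_le_left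
  have h𝒰c : ∀ᶠ i in (𝒰 : Filter I), c < p i (((F i).card : ℂ)⁻¹ • ∑ t ∈ F i, T t x) ^ 2 :=
    le_principal_iff.1 (h𝒰.trans inf_le_right)
  obtain ⟨ν, hν_pos, hν⟩ := exists_tendsto_ultrafilter 𝒰 φ hφ_pos hφ_bdd
  have hν_re : ∀ a, Tendsto (fun i => (φ i a).re) 𝒰 (nhds (ν a).re) := fun a =>
    (Complex.continuous_re.tendsto _).comp (hν a)
  have hν_inv : ∀ s a, ν (S s a) = ν a := fun s a => by
    obtain ⟨K, hK⟩ := hbdd a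
    have h0 := (tendsto_seminorm_average_sub_mul_right hrc F s (hF s)
      (fun _ => normSeminorm ℂ ℂ) (fun i t => μ i (S t a)) hK).mono_left h𝒰top
    simp only [coe_normSeminorm] at h0
    rw [← tendsto_zero_iff_norm_tendsto_zero] at h0
    have h1 := (hν a).sub (hν (S s a))
    refine (sub_eq_zero.1 (tendsto_nhds_unique h1 (h0.congr fun i => ?_))).symm
    simp only [hφ_apply, hSrep, smul_eq_mul, mul_sub, mul_apply_eq_comp]
  obtain ⟨q, hq⟩ := exists_seminorm_sq_eq ip ip_nonneg ip_star ip_add ip_smul ν hν_pos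
  have hqT : ∀ t y, q (T t y) ≤ q y := fun t y => by
    rw [← pow_le_pow_iff_left₀ (apply_nonneg _ _) (apply_nonneg _ _) two_ne_zero, hq, hq,
      ← hν_inv t (ip y y)]
    exact hmono ν hν_pos _ _ (hTdom t y)
  have hc_le : ∀ n ∈ Submodule.span ℂ (Set.range fun z : E × 𝒮 => z.1 - T z.2 z.1),
      c ≤ q (x + n) ^ 2 := fun n hn => by
    have h0 := (tendsto_seminorm_average_of_mem_span hrc F hF T hTrep p hpT hn).mono_left h𝒰top
    have h1 := (((hν_re (ip (x + n) (x + n))).sqrt).add h0).pow 2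
    rw [add_zero, ← hq, Real.sq_sqrt (sq_nonneg _)] at h1
    refine ge_of_tendsto h1 (h𝒰c.mono fun i hi => hi.le.trans ?_)
    refine pow_le_pow_left₀ (apply_nonneg _ _) ?_ 2
    have hsplit : ((F i).card : ℂ)⁻¹ • ∑ t ∈ F i, T t x
        = ((F i).card : ℂ)⁻¹ • ∑ t ∈ F i, T t (x + n)
          - ((F i).card : ℂ)⁻¹ • ∑ t ∈ F i, T t n := by
      simp only [map_add, sum_add_distrib, smul_add, add_sub_cancel_right]
    rw [hsplit]
    exact (map_sub_le_add _ _ _).trans (add_le_add_left (hpavg i _) _)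
  obtain ⟨K, hK⟩ := hlimsup_le
  refine le_of_forall_pos_le_add fun ε hε => ?_
  rw [← sub_le_iff_le_add]
  refine le_liminf_of_le
    (IsBoundedUnder.isCoboundedUnder_ge (isBoundedUnder_of ⟨K, fun j => ?_⟩)) ?_
  · have hc : (0 : ℝ) < (G j).card := by exact_mod_cast (hGne j).card_pos
    rw [inv_mul_le_iff₀ hc, ← nsmul_eq_mul]
    exact sum_le_card_nsmul _ _ _ fun s _ => hK s
  · filter_upwards [eventually_sub_le_inner_average hrc G hGne hG T hTrep q hqT
      (fun y z => (ν (ip y z)).re) (fun a b y z => by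
        simp only [hq]
        exact re_map_ip_combination ip ip_star ip_add ip_smul ν hν_pos a b y z) x hc_le hε]
      with j hj
    refine hj.trans ?_
    rw [hip_avg, map_smul, map_sum, smul_eq_mul, ← Complex.ofReal_natCast, ← Complex.ofReal_inv,
      Complex.re_ofReal_mul, Complex.re_sum]
    gcongr with s
    rw [← (hν_re (ip x (T s x))).limsup_eq]
    exact limsup_le_limsup_of_le h𝒰top (hν_re _).isCoboundedUnder_le (hr_bdd_above _)

/-- **Van der Corput inequality on pre-Hilbert modules along Følner nets.**
Let `𝒮` be a right cancellative semigroup with right Følner nets `(F i)` and `(G j)`, let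
`E` be a pre-Hilbert module (with `A`-valued inner product `ip`) over a commutative unital
C*-algebra `A`, let `S : 𝒮 → 𝓛(A)` be a semigroup representation by Markov operators, let
`T : 𝒮 → 𝓛(E)` be a semigroup representation such that `T t` is `S t`-dominated for every
`t` (note `|y|_A² = ip y y`, so domination reads `ip (T t y) (T t y) ≤ S t (ip y y)` and
boundedness of each `T t` reads `‖ip (T t y) (T t y)‖ ≤ C t * ‖ip y y‖`), and let `μ i` be a
state on `A` for every `i`.  Then for every `x ∈ E`,
`limsup_i ⟨|(1/|Fᵢ|) ∑_{t∈Fᵢ} Tₜ x|_A², μᵢ⟩ ≤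
  liminf_j (1/|Gⱼ|) ∑_{s∈Gⱼ} limsup_i (1/|Fᵢ|) ∑_{t∈Fᵢ} Re ⟨Sₜ (x | Tₛ x)_A, μᵢ⟩`. -/
theorem vdc_module_folner {𝒮 : Type*} [Semigroup 𝒮] [DecidableEq 𝒮]
    (hrc : ∀ r s t : 𝒮, r * t = s * t → r = s)
    {I : Type*} [Preorder I] [IsDirected I (· ≤ ·)] [Nonempty I]
    {J : Type*} [Preorder J] [IsDirected J (· ≤ ·)] [Nonempty J]
    (F : I → Finset 𝒮) (hFne : ∀ i, (F i).Nonempty)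
    (hF : ∀ s : 𝒮,
      Tendsto (fun i => ((symmDiff ((F i).image (· * s)) (F i)).card : ℝ) / (F i).card)
        atTop (nhds 0))
    (G : J → Finset 𝒮) (hGne : ∀ j, (G j).Nonempty)
    (hG : ∀ s : 𝒮,
      Tendsto (fun j => ((symmDiff ((G j).image (· * s)) (G j)).card : ℝ) / (G j).card)
        atTop (nhds 0))
    {A : Type*} [NormedCommRing A] [StarRing A] [CStarRing A]
    [NormedAlgebra ℂ A] [CompleteSpace A] [StarModule ℂ A]
    [PartialOrder A] [StarOrderedRing A]
    {E : Type*} [AddCommGroup E] [Module ℂ E] [Module A E] [IsScalarTower ℂ A E]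
    (ip : E → E → A)
    (ip_nonneg : ∀ y : E, 0 ≤ ip y y)
    (ip_definite : ∀ y : E, ip y y = 0 → y = 0)
    (ip_star : ∀ y z : E, star (ip y z) = ip z y)
    (ip_add : ∀ y z w : E, ip (y + z) w = ip y w + ip z w)
    (ip_smul : ∀ (a : A) (y z : E), ip (a • y) z = a * ip y z)
    (S : 𝒮 → A →L[ℂ] A)
    (hSrep : ∀ s t : 𝒮, S (s * t) = S s * S t)
    (hS1 : ∀ t : 𝒮, S t 1 = 1)
    (hSpos : ∀ t : 𝒮, ∀ a : A, 0 ≤ a → 0 ≤ S t a)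
    (T : 𝒮 → E →ₗ[ℂ] E)
    (hTrep : ∀ s t : 𝒮, T (s * t) = T s * T t)
    (hTbdd : ∀ t : 𝒮, ∃ C : ℝ, 0 ≤ C ∧ ∀ y : E, ‖ip (T t y) (T t y)‖ ≤ C * ‖ip y y‖)
    (hTdom : ∀ t : 𝒮, ∀ y : E, ip (T t y) (T t y) ≤ S t (ip y y))
    (μ : I → A →L[ℂ] ℂ)
    (hμpos : ∀ i, ∀ a : A, 0 ≤ a → 0 ≤ μ i a)
    (hμnorm : ∀ i, ‖μ i‖ = 1)
    (x : E) :
    limsup (fun i =>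
        (μ i (ip (((F i).card : ℂ)⁻¹ • ∑ t ∈ F i, T t x)
                 (((F i).card : ℂ)⁻¹ • ∑ t ∈ F i, T t x))).re) atTop ≤
      liminf (fun j => ((G j).card : ℝ)⁻¹ * ∑ s ∈ G j,
        limsup (fun i =>
          ((F i).card : ℝ)⁻¹ * ∑ t ∈ F i, (μ i (S t (ip x (T s x)))).re) atTop)
        atTop := by
  let _ : CStarAlgebra A := { }
  refine vdc_cstar_valued_ip hrc F hFne hF G hGne hG ip ip_nonneg ip_star ip_add
    (fun c y z => ?_) S hSrep hS1 hSpos T hTrep hTdom μ hμpos hμnorm x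
  rw [← one_smul A y, ← smul_assoc, ip_smul, ip_smul, smul_mul_assoc]
end
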